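/- arXiv:1205.6346 — 3 statements merged into one kernel-verified Lean document; each statement's English description precedes it below -/
import Mathlib

section
/- In every multiplayer quantitative reachability game with tuples of strictly positive costs on edges, played from any initial vertex v₀, there exists a subgame perfect equilibrium. -/
open scoped Classical ENat

/-- A multiplayer quantitative reachability game with tuples of strictly
positive costs on edges. -/
structure QRGameC (ι V : Type) where
  owner : V → ι
  E : V → V → Prop
  total : ∀ v, ∃ w, E v w
  cst : ι → V → V → ℝ
  cst_pos : ∀ i v w, E v w → 0 < cst i v w
  F : ι → Set V
  F_ne : ∀ i, (F i).Nonempty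

namespace QRGameC

variable {ι V : Type}

/-- Histories, encoded as *reversed* nonempty lists: the head is the current
vertex and the last element is the initial vertex `v₀`. -/
def IsHist (G : QRGameC ι V) (v₀ : V) : List V → Prop
  | [] => False
  | [v] => v = v₀
  | v :: w :: t => G.E w v ∧ IsHist G v₀ (w :: t)

/-- The current (most recent) vertex of a history. -/
def cur (v₀ : V) (h : List V) : V := h.headD v₀

/-- `σ` is a valid strategy of player `i`. -/
def IsStrat (G : QRGameC ι V) (v₀ : V) (i : ι) (σ : List V → V) : Prop :=
  ∀ h : List V, G.IsHist v₀ h → G.owner (cur v₀ h) = i → G.E (cur v₀ h) (σ h)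

/-- A strategy profile: one valid strategy for each player. -/
def IsProfile (G : QRGameC ι V) (v₀ : V) (σ : ι → List V → V) : Prop :=
  ∀ i, G.IsStrat v₀ i (σ i)

/-- The history reached after `n` further steps following profile `σ` from `h`. -/
def histFrom (G : QRGameC ι V) (v₀ : V) (σ : ι → List V → V) (h : List V) : ℕ → List V
  | 0 => h
  | n + 1 =>
      σ (G.owner (cur v₀ (histFrom G v₀ σ h n))) (histFrom G v₀ σ h n)
        :: histFrom G v₀ σ h n

/-- The full play whose prefix is `h`, consistent with `σ` after `h`. -/
def fullPlay (G : QRGameC ι V) (v₀ : V) (σ : ι → List V → V) (h : List V) (t : ℕ) : V :=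
  (G.histFrom v₀ σ h t).reverse.getD t v₀

/-- Cost of player `i` for a play `ρ`: the sum of the edge costs of player `i`
up to the first visit of `F i`, and `+∞` if `F i` is never visited. -/
noncomputable def cost (G : QRGameC ι V) (i : ι) (ρ : ℕ → V) : EReal :=
  if h : ∃ l, ρ l ∈ G.F i then
    ((∑ k ∈ Finset.range (Nat.find h), G.cst i (ρ k) (ρ (k + 1)) : ℝ) : EReal)
  else ⊤

variable [DecidableEq ι]

/-- `σ` restricted after `h` is a Nash equilibrium in the subgame `(G|_h, cur h)`. -/
def IsNashAfter (G : QRGameC ι V) (v₀ : V) (σ : ι → List V → V) (h : List V) : Prop :=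
  ∀ (j : ι) (σ' : List V → V), G.IsStrat v₀ j σ' →
    G.cost j (G.fullPlay v₀ σ h) ≤ G.cost j (G.fullPlay v₀ (Function.update σ j σ') h)

/-- A subgame perfect equilibrium: a Nash equilibrium in every subgame. -/
def IsSPE (G : QRGameC ι V) (v₀ : V) (σ : ι → List V → V) : Prop :=
  ∀ h : List V, G.IsHist v₀ h → G.IsNashAfter v₀ σ h

end QRGameC

namespace QRGameC

variable {ι V : Type}

/-! ### Histories and plays -/

theorem IsHist.ne_nil {G : QRGameC ι V} {v₀ : V} {h : List V} (hh : G.IsHist v₀ h) : h ≠ [] := by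
  rintro rfl
  exact hh

theorem IsHist.cons {G : QRGameC ι V} {v₀ w : V} {h : List V} (hh : G.IsHist v₀ h)
    (hw : G.E (cur v₀ h) w) : G.IsHist v₀ (w :: h) := by
  cases h with
  | nil => exact hh.elim
  | cons v t => exact ⟨hw, hh⟩

theorem IsHist.edge {G : QRGameC ι V} {v₀ : V} {H : List V} (hH : G.IsHist v₀ H) {k : ℕ}
    (hk : k + 1 < H.length) : G.E (H.reverse.getD k v₀) (H.reverse.getD (k + 1) v₀) := by
  induction H with
  | nil => exact hH.elim
  | cons v t ih =>
    cases t with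
    | nil => simp at hk
    | cons w t =>
      obtain ⟨hE, hH⟩ := hH
      rw [List.reverse_cons (a := v), List.getD_append _ _ _ _ (by simp at hk ⊢; omega)]
      by_cases hlt : k + 1 < (w :: t).length
      · rw [List.getD_append _ _ _ _ (by simpa using hlt)]
        exact ih hH hlt
      · have hk' : k = t.length := by simp at hk hlt; omega
        subst hk'
        simpa using hE

theorem length_histFrom (G : QRGameC ι V) (v₀ : V) (σ : ι → List V → V) (h : List V) (n : ℕ) :
    (G.histFrom v₀ σ h n).length = h.length + n := by
  induction n with
  | zero => rfl
  | succ n ih => simp [histFrom, ih]; omega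

theorem histFrom_succ_eq_histFrom_cons (G : QRGameC ι V) (v₀ : V) (σ : ι → List V → V)
    (h : List V) (n : ℕ) :
    G.histFrom v₀ σ h (n + 1) = G.histFrom v₀ σ (σ (G.owner (cur v₀ h)) h :: h) n := by
  induction n with
  | zero => rfl
  | succ n ih => rw [histFrom, ih]; rfl

theorem IsHist.histFrom {G : QRGameC ι V} {v₀ : V} {σ : ι → List V → V} (hσ : G.IsProfile v₀ σ)
    {h : List V} (hh : G.IsHist v₀ h) (n : ℕ) : G.IsHist v₀ (G.histFrom v₀ σ h n) := by
  induction n with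
  | zero => exact hh
  | succ n ih => exact ih.cons (hσ _ _ ih rfl)

theorem histFrom_congr (G : QRGameC ι V) (v₀ : V) {σ τ : ι → List V → V} {h : List V} {N : ℕ}
    (hστ : ∀ t < N, ∀ i, τ i (G.histFrom v₀ σ h t) = σ i (G.histFrom v₀ σ h t)) :
    ∀ t ≤ N, G.histFrom v₀ τ h t = G.histFrom v₀ σ h t := by
  intro t
  induction t with
  | zero => intro _; rfl
  | succ t ih =>
    intro ht
    rw [histFrom, histFrom, ih (by omega), hστ t (by omega)]

theorem getD_reverse_histFrom (G : QRGameC ι V) (v₀ : V) (σ : ι → List V → V) {h : List V}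
    (hh : h ≠ []) {t m : ℕ} (htm : t ≤ m) :
    (G.histFrom v₀ σ h m).reverse.getD t v₀ = G.fullPlay v₀ σ h t := by
  induction m, htm using Nat.le_induction with
  | base => rfl
  | succ m htm ih =>
    have := List.length_pos_iff.mpr hh
    rw [histFrom, List.reverse_cons, List.getD_append, ih]
    rw [List.length_reverse, length_histFrom]
    omega

theorem fullPlay_congr (G : QRGameC ι V) (v₀ : V) {σ τ : ι → List V → V} {h : List V} {N : ℕ}
    (hστ : ∀ t < N, ∀ i, τ i (G.histFrom v₀ σ h t) = σ i (G.histFrom v₀ σ h t))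
    {t : ℕ} (ht : t ≤ N) : G.fullPlay v₀ τ h t = G.fullPlay v₀ σ h t := by
  rw [fullPlay, fullPlay, G.histFrom_congr v₀ hστ t ht]

/-! ### Costs -/

theorem cost_eq_sum (G : QRGameC ι V) (i : ι) {ρ : ℕ → V} {l : ℕ} (hl : ρ l ∈ G.F i)
    (hmin : ∀ k < l, ρ k ∉ G.F i) :
    G.cost i ρ = ((∑ k ∈ Finset.range l, G.cst i (ρ k) (ρ (k + 1)) : ℝ) : EReal) := by
  have h : ∃ l, ρ l ∈ G.F i := ⟨l, hl⟩
  have hf : Nat.find h = l := (Nat.find_eq_iff h).mpr ⟨hl, hmin⟩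
  rw [cost, dif_pos h, hf]

theorem cost_congr (G : QRGameC ι V) (i : ι) {ρ ρ' : ℕ → V} {l : ℕ} (hl : ρ l ∈ G.F i)
    (hρ : ∀ k ≤ l, ρ' k = ρ k) : G.cost i ρ' = G.cost i ρ := by
  have h : ∃ l, ρ l ∈ G.F i := ⟨l, hl⟩
  have hle : Nat.find h ≤ l := Nat.find_min' h hl
  rw [G.cost_eq_sum i (Nat.find_spec h) fun k hk => Nat.find_min h hk,
    G.cost_eq_sum i (ρ := ρ') (l := Nat.find h)]
  · congr 1
    refine Finset.sum_congr rfl fun k hk => ?_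
    have := Finset.mem_range.mp hk
    rw [hρ k (by omega), hρ (k + 1) (by omega)]
  · rw [hρ _ hle]
    exact Nat.find_spec h
  · intro k hk
    rw [hρ k (by omega)]
    exact Nat.find_min h hk

/-- The cost of a history for player `i`: the cost up to the first visit of `F i`, and `+∞` if
the history does not visit `F i`. -/
noncomputable def histCost (G : QRGameC ι V) (v₀ : V) (i : ι) (H : List V) : EReal :=
  if ∃ l < H.length, H.reverse.getD l v₀ ∈ G.F i then
    G.cost i fun t => H.reverse.getD t v₀
  else ⊤

theorem exists_pos_le_cst [Finite V] (G : QRGameC ι V) (i : ι) :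
    ∃ c > 0, ∀ v w, G.E v w → c ≤ G.cst i v w := by
  rcases {e : V × V | G.E e.1 e.2}.eq_empty_or_nonempty with hE | hE
  · exact ⟨1, one_pos, fun v w h => (hE.subset (show (v, w) ∈ _ from h)).elim⟩
  · obtain ⟨e, he, hmin⟩ := Set.exists_min_image _ (fun e : V × V => G.cst i e.1 e.2)
      (Set.toFinite _) hE
    exact ⟨_, G.cst_pos i _ _ he, fun v w h => hmin (v, w) h⟩

/-- A history of bounded cost visits the goal set early. -/
theorem exists_visit_of_histCost_le (G : QRGameC ι V) {v₀ : V} {i : ι} {H : List V}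
    (hH : G.IsHist v₀ H) {c C : ℝ} (hc : ∀ v w, G.E v w → c ≤ G.cst i v w)
    (hC : G.histCost v₀ i H ≤ (C : EReal)) :
    ∃ p, H.reverse.getD p v₀ ∈ G.F i ∧ p * c ≤ C ∧
      G.histCost v₀ i H = G.cost i fun t => H.reverse.getD t v₀ := by
  by_cases h : ∃ l < H.length, H.reverse.getD l v₀ ∈ G.F i
  · have hcost : G.histCost v₀ i H = G.cost i fun t => H.reverse.getD t v₀ := if_pos h
    obtain ⟨l, hlH, hl⟩ := h
    have hex : ∃ l, H.reverse.getD l v₀ ∈ G.F i := ⟨l, hl⟩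
    have hle : Nat.find hex ≤ l := Nat.find_min' hex hl
    refine ⟨Nat.find hex, Nat.find_spec hex, ?_, hcost⟩
    rw [hcost, G.cost_eq_sum i (ρ := fun t => H.reverse.getD t v₀) (Nat.find_spec hex)
      fun k hk => Nat.find_min hex hk, EReal.coe_le_coe_iff] at hC
    refine le_trans ?_ hC
    have := Finset.card_nsmul_le_sum (Finset.range (Nat.find hex))
      (fun k => G.cst i (H.reverse.getD k v₀) (H.reverse.getD (k + 1) v₀)) c fun k hk =>
        hc _ _ (hH.edge (by have := Finset.mem_range.mp hk; omega))
    simpa using this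
  · rw [histCost, if_neg h, top_le_iff] at hC
    exact (EReal.coe_ne_top C hC).elim

/-! ### Backward induction in finite-horizon games -/

theorem exists_argmin_edge [Finite V] (G : QRGameC ι V) (v : V) (f : V → EReal) :
    ∃ w, G.E v w ∧ ∀ w', G.E v w' → f w ≤ f w' :=
  Set.exists_min_image {w | G.E v w} f (Set.toFinite _) (G.total v)

/-- A successor of `v` minimizing `f`. -/
noncomputable def argminEdge [Finite V] (G : QRGameC ι V) (v : V) (f : V → EReal) : V :=
  (G.exists_argmin_edge v f).choose

/-- The final history obtained by backward induction with `m` steps remaining after `h`, when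
player `i` wants to minimize `K i` of the final history. -/
noncomputable def optimalHist [Finite V] (G : QRGameC ι V) (v₀ : V) (K : ι → List V → EReal) :
    ℕ → List V → List V
  | 0, h => h
  | m + 1, h =>
      optimalHist G v₀ K m
        (G.argminEdge (cur v₀ h)
          (fun w => K (G.owner (cur v₀ h)) (optimalHist G v₀ K m (w :: h))) :: h)

/-- The backward induction strategy in the game that stops when the history has length `n`. -/
noncomputable def optimalMove [Finite V] (G : QRGameC ι V) (v₀ : V) (K : ι → List V → EReal)
    (n : ℕ) (h : List V) : V :=
  G.argminEdge (cur v₀ h)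
    fun w => K (G.owner (cur v₀ h)) (optimalHist G v₀ K (n - h.length - 1) (w :: h))

theorem edge_optimalMove [Finite V] (G : QRGameC ι V) (v₀ : V) (K : ι → List V → EReal)
    (n : ℕ) (h : List V) : G.E (cur v₀ h) (G.optimalMove v₀ K n h) :=
  (G.exists_argmin_edge _ _).choose_spec.1

theorem optimalHist_succ [Finite V] (G : QRGameC ι V) (v₀ : V) (K : ι → List V → EReal)
    {n m : ℕ} {h : List V} (hm : h.length + (m + 1) = n) :
    G.optimalHist v₀ K (m + 1) h = G.optimalHist v₀ K m (G.optimalMove v₀ K n h :: h) := by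
  have : n - h.length - 1 = m := by omega
  rw [optimalMove, this, optimalHist]

theorem histFrom_optimalMove [Finite V] (G : QRGameC ι V) (v₀ : V) (K : ι → List V → EReal)
    {n m : ℕ} {h : List V} (hm : h.length + m = n) :
    G.histFrom v₀ (fun _ => G.optimalMove v₀ K n) h m = G.optimalHist v₀ K m h := by
  induction m generalizing h with
  | zero => rfl
  | succ m ih =>
    rw [histFrom_succ_eq_histFrom_cons, G.optimalHist_succ v₀ K hm]
    exact ih (by simp; omega)

theorem optimalHist_le [Finite V] [DecidableEq ι] (G : QRGameC ι V) (v₀ : V)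
    (K : ι → List V → EReal) {j : ι} {σ' : List V → V} (hσ' : G.IsStrat v₀ j σ')
    {n m : ℕ} {h : List V} (hh : G.IsHist v₀ h) (hm : h.length + m = n) :
    K j (G.optimalHist v₀ K m h) ≤
      K j (G.histFrom v₀ (Function.update (fun _ => G.optimalMove v₀ K n) j σ') h m) := by
  induction m generalizing h with
  | zero => exact le_rfl
  | succ m ih =>
    rw [histFrom_succ_eq_histFrom_cons, G.optimalHist_succ v₀ K hm]
    by_cases hj : G.owner (cur v₀ h) = j
    · rw [hj, Function.update_self]
      have hE := hσ' h hh hj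
      refine le_trans ?_ (ih (hh.cons hE) (by simp; omega))
      have hmin := (G.exists_argmin_edge (cur v₀ h) fun w =>
        K (G.owner (cur v₀ h)) (G.optimalHist v₀ K (n - h.length - 1) (w :: h))).choose_spec.2 _ hE
      have hnm : n - h.length - 1 = m := by omega
      simpa only [optimalMove, argminEdge, hnm, hj] using hmin
    · rw [Function.update_of_ne hj]
      exact ih (hh.cons (G.edge_optimalMove v₀ K n h)) (by simp; omega)

/-! ### Passing to the limit -/

theorem exists_ultrafilter_limit {α β : Type} [Finite β] (U : Ultrafilter ℕ) (s : ℕ → α → β) :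
    ∃ f : α → β, ∀ a, ∀ᶠ n in (U : Filter ℕ), s n a = f a := by
  have h : ∀ a, ∃ b, ∀ᶠ n in (U : Filter ℕ), s n a = b := fun a =>
    (Ultrafilter.eventually_exists_iff (P := fun b n => s n a = b)).mp
      (Filter.Eventually.of_forall fun n => ⟨_, rfl⟩)
  exact ⟨fun a => (h a).choose, fun a => (h a).choose_spec⟩

theorem isSPE_of_eventually_eq [Finite V] [DecidableEq ι] (G : QRGameC ι V) (v₀ : V)
    {L : Filter ℕ} [L.NeBot] (hL : L ≤ Filter.atTop) {s : List V → V}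
    (hs : ∀ h, ∀ᶠ n in L, G.optimalMove v₀ (G.histCost v₀) n h = s h) :
    G.IsSPE v₀ fun _ => s := by
  intro h hh j σ' hσ'
  by_contra! hlt
  set ρ := G.fullPlay v₀ (fun _ => s) h
  set ρ' := G.fullPlay v₀ (Function.update (fun _ => s) j σ') h
  have hvisit : ∃ l, ρ' l ∈ G.F j := by
    by_contra hno
    rw [cost, dif_neg hno] at hlt
    exact not_top_lt hlt
  obtain ⟨C, hC⟩ : ∃ C : ℝ, G.cost j ρ' = C := ⟨_, dif_pos hvisit⟩
  obtain ⟨l, hl⟩ := hvisit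
  obtain ⟨c, hc0, hc⟩ := G.exists_pos_le_cst j
  obtain ⟨M, hM⟩ := exists_nat_gt (C / c)
  set N := max M l
  have hag : ∀ τ : ι → List V → V, ∀ᶠ n in L, ∀ t < N,
      G.optimalMove v₀ (G.histCost v₀) n (G.histFrom v₀ τ h t) = s (G.histFrom v₀ τ h t) :=
    fun τ => (Filter.eventually_all_finite (Set.finite_lt_nat N)).mpr fun t _ => hs _
  obtain ⟨n, ⟨hn1, hn2⟩, hn⟩ := ((hag fun _ => s).and
    (hag (Function.update (fun _ => s) j σ'))).and
      (hL (Filter.eventually_ge_atTop (h.length + N))) |>.exists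
  obtain ⟨m, rfl⟩ : ∃ m, n = h.length + m := ⟨n - h.length, by omega⟩
  have hNm : N ≤ m := by omega
  set s' := G.optimalMove v₀ (G.histCost v₀) (h.length + m)
  have hplay : ∀ t ≤ N, (G.histFrom v₀ (fun _ => s') h m).reverse.getD t v₀ = ρ t := fun t ht => by
    rw [G.getD_reverse_histFrom v₀ _ hh.ne_nil (ht.trans hNm)]
    exact G.fullPlay_congr v₀ (fun t ht _ => hn1 t ht) ht
  have hplay' : ∀ t ≤ N,
      (G.histFrom v₀ (Function.update (fun _ => s') j σ') h m).reverse.getD t v₀ = ρ' t :=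
    fun t ht => by
      rw [G.getD_reverse_histFrom v₀ _ hh.ne_nil (ht.trans hNm)]
      refine G.fullPlay_congr v₀ (fun t ht i => ?_) ht
      by_cases hi : i = j
      · subst hi
        rw [Function.update_self, Function.update_self]
      · rw [Function.update_of_ne hi, Function.update_of_ne hi]
        exact hn2 t ht
  have hlN : l ≤ N := le_max_right _ _
  have hcost' : G.histCost v₀ j (G.histFrom v₀ (Function.update (fun _ => s') j σ') h m) = C := by
    rw [histCost, if_pos, ← hC]
    · exact G.cost_congr j hl fun k hk => hplay' k (hk.trans hlN)
    · refine ⟨l, ?_, by rwa [hplay' l hlN]⟩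
      have := List.length_pos_iff.mpr hh.ne_nil
      rw [length_histFrom]
      omega
  have hle := G.optimalHist_le v₀ (G.histCost v₀) hσ' hh rfl (m := m)
  rw [hcost', ← G.histFrom_optimalMove v₀ (G.histCost v₀) rfl] at hle
  obtain ⟨p, hp, hpC, hpcost⟩ := G.exists_visit_of_histCost_le
    (IsHist.histFrom (fun _ h _ _ => G.edge_optimalMove v₀ _ _ h) hh m) hc hle
  have hpM : p < M := by
    have : (p : ℝ) ≤ C / c := (le_div_iff₀ hc0).mpr hpC
    exact_mod_cast this.trans_lt hM
  have hpN : p ≤ N := hpM.le.trans (le_max_left _ _)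
  rw [hpcost, ← hC] at hle
  have := G.cost_congr j (ρ' := ρ) hp fun k hk => (hplay k (hk.trans hpN)).symm
  rw [this] at hlt
  exact absurd hle hlt.not_ge

end QRGameC

/-- In every multiplayer quantitative reachability game with tuples of strictly
positive costs on edges, played from any initial vertex, there exists a subgame
perfect equilibrium. -/
theorem exists_subgame_perfect_equilibrium_edge_costs
    {ι V : Type} [Fintype ι] [Fintype V] [DecidableEq ι]
    (G : QRGameC ι V) (v₀ : V) :
    ∃ σ : ι → List V → V, G.IsProfile v₀ σ ∧ G.IsSPE v₀ σ := by
  obtain ⟨s, hs⟩ := QRGameC.exists_ultrafilter_limit (Filter.hyperfilter ℕ)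
    (G.optimalMove v₀ (G.histCost v₀))
  refine ⟨fun _ => s, fun i h _ _ => ?_,
    G.isSPE_of_eventually_eq v₀ Nat.hyperfilter_le_atTop hs⟩
  obtain ⟨n, hn⟩ := (hs h).exists
  change G.E _ (s h)
  rw [← hn]
  exact G.edge_optimalMove v₀ _ n h
end

section
/- In every two-player quantitative reachability game (G, v₀) (i.e. with |Π| = 2), there exists a subgame perfect secure equilibrium, i.e. a strategy profile (σ₁, σ₂) such that for every history hv of the game, the restricted profile (σ₁|_h, σ₂|_h) is a secure equilibrium in the subgame (G|_h, v). -/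
open scoped Classical ENat

/-- A multiplayer quantitative reachability game: a finite directed graph whose
vertices are partitioned among the players (via `owner`), every vertex has an
outgoing edge, and each player `i` has a nonempty goal set `F i`. -/
structure QRGame (ι V : Type) where
  owner : V → ι
  E : V → V → Prop
  total : ∀ v, ∃ w, E v w
  F : ι → Set V
  F_ne : ∀ i, (F i).Nonempty

namespace QRGame

variable {ι V : Type}

/-- Histories are encoded as *reversed* nonempty lists: the head is the current
vertex, the last element is the initial vertex `v₀`, and consecutive elements
are joined by edges of the graph. -/
def IsHist (G : QRGame ι V) (v₀ : V) : List V → Prop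
  | [] => False
  | [v] => v = v₀
  | v :: w :: t => G.E w v ∧ IsHist G v₀ (w :: t)

/-- The current (i.e. most recent) vertex of a history. -/
def cur (v₀ : V) (h : List V) : V := h.headD v₀

/-- `σ` is a valid strategy of player `i`: on every history whose current
vertex belongs to player `i`, it chooses a successor along an edge. -/
def IsStrat (G : QRGame ι V) (v₀ : V) (i : ι) (σ : List V → V) : Prop :=
  ∀ h : List V, G.IsHist v₀ h → G.owner (cur v₀ h) = i → G.E (cur v₀ h) (σ h)

/-- A strategy profile: one valid strategy for each player. -/
def IsProfile (G : QRGame ι V) (v₀ : V) (σ : ι → List V → V) : Prop :=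
  ∀ i, G.IsStrat v₀ i (σ i)

/-- The history reached after `n` further steps when all players follow the
profile `σ` from the history `h` on. -/
def histFrom (G : QRGame ι V) (v₀ : V) (σ : ι → List V → V) (h : List V) : ℕ → List V
  | 0 => h
  | n + 1 =>
      σ (G.owner (cur v₀ (histFrom G v₀ σ h n))) (histFrom G v₀ σ h n)
        :: histFrom G v₀ σ h n

/-- The full play (indexed from time `0`) whose prefix is the history `h` and
which is consistent with the profile `σ` after `h`. -/
def fullPlay (G : QRGame ι V) (v₀ : V) (σ : ι → List V → V) (h : List V) (t : ℕ) : V :=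
  (G.histFrom v₀ σ h t).reverse.getD t v₀

/-- The outcome `⟨(σ_i)⟩_{v₀}` of the profile `σ` from the initial vertex. -/
def outcome (G : QRGame ι V) (v₀ : V) (σ : ι → List V → V) : ℕ → V :=
  G.fullPlay v₀ σ [v₀]

/-- Cost of player `i` for a play `ρ`: the least `l` with `ρ l ∈ F i`,
and `⊤` (i.e. `+∞`) if there is no such `l`. -/
noncomputable def cost (G : QRGame ι V) (i : ι) (ρ : ℕ → V) : ℕ∞ :=
  ⨅ l ∈ {l : ℕ | ρ l ∈ G.F i}, (l : ℕ∞)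

/-- Cost of player `i` for the finite prefix `ρ₀ … ρ_{m-1}` of a play. -/
noncomputable def costLT (G : QRGame ι V) (i : ι) (ρ : ℕ → V) (m : ℕ) : ℕ∞ :=
  ⨅ l ∈ {l : ℕ | l < m ∧ ρ l ∈ G.F i}, (l : ℕ∞)

end QRGame

/-- The preference relation `≺_j` of player `j` on cost profiles:
`x ≺_j y` iff `x j > y j`, or `x j = y j`, every player's cost does not
decrease, and some player's cost strictly increases. -/
def Prec {ι : Type} (j : ι) (x y : ι → ℕ∞) : Prop :=
  y j < x j ∨ (x j = y j ∧ (∀ i, x i ≤ y i) ∧ ∃ i, x i < y i)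

namespace QRGame

variable {ι V : Type} [DecidableEq ι]

/-- `σ` restricted after the history `h` is a secure equilibrium in the subgame
`(G|_h, cur h)`: no player `j` has a `≺_j`-profitable deviation after `h`
(costs are computed on the whole play, including the prefix `h`). -/
def IsSecureAfter (G : QRGame ι V) (v₀ : V) (σ : ι → List V → V) (h : List V) : Prop :=
  ¬ ∃ (j : ι) (σ' : List V → V), G.IsStrat v₀ j σ' ∧
      Prec j (fun i => G.cost i (G.fullPlay v₀ σ h))
        (fun i => G.cost i (G.fullPlay v₀ (Function.update σ j σ') h))

/-- A secure equilibrium in `(G, v₀)`. -/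
def IsSecure (G : QRGame ι V) (v₀ : V) (σ : ι → List V → V) : Prop :=
  G.IsSecureAfter v₀ σ [v₀]

/-- A subgame perfect secure equilibrium: a secure equilibrium in every subgame. -/
def IsSPSE (G : QRGame ι V) (v₀ : V) (σ : ι → List V → V) : Prop :=
  ∀ h : List V, G.IsHist v₀ h → G.IsSecureAfter v₀ σ h

end QRGame

namespace QRGame

section Auxiliary

variable {ι V : Type}

/-- Cost of player `i` along a (reversed) history, `⊤` if the goal set was not visited. -/
noncomputable def histCost (G : QRGame ι V) (i : ι) : List V → ℕ∞
  | [] => ⊤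
  | w :: h => min (histCost G i h) (if w ∈ G.F i then (h.length : ℕ∞) else ⊤)

lemma histCost_cons_le (G : QRGame ι V) (i : ι) (w : V) (h : List V) :
    G.histCost i (w :: h) ≤ G.histCost i h :=
  min_le_left _ _

lemma min_histCost_length_le_cons (G : QRGame ι V) (i : ι) (w : V) (h : List V) :
    min (G.histCost i h) h.length ≤ G.histCost i (w :: h) := by
  rw [histCost]
  split_ifs <;> simp

lemma histCost_lt_length (G : QRGame ι V) (i : ι) (h : List V) (hh : G.histCost i h ≠ ⊤) :
    G.histCost i h < h.length := by
  induction h with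
  | nil => simp [histCost] at hh
  | cons w h ih =>
    have hlt : (h.length : ℕ∞) < ((w :: h).length : ℕ∞) := by
      exact_mod_cast Nat.lt_succ_self _
    by_cases h' : G.histCost i h = ⊤
    · rw [histCost, h'] at hh ⊢
      split_ifs at hh ⊢ with hw
      · simpa using hlt
      · simp at hh
    · exact (G.histCost_cons_le i w h).trans_lt ((ih h').trans hlt)

lemma histCost_cons_eq (G : QRGame ι V) (i : ι) (w : V) (h : List V)
    (hi : G.histCost i h ≠ ⊤) : G.histCost i (w :: h) = G.histCost i h := by
  refine le_antisymm (G.histCost_cons_le i w h) ?_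
  have := G.min_histCost_length_le_cons i w h
  rwa [min_eq_left (G.histCost_lt_length i h hi).le] at this

lemma cost_le_histCost (G : QRGame ι V) (v₀ : V) (i : ι) (ρ : ℕ → V) (h : List V)
    (hρ : ∀ l < h.length, h.reverse.getD l v₀ = ρ l) : G.cost i ρ ≤ G.histCost i h := by
  induction h with
  | nil => simp [histCost]
  | cons w h ih =>
    rw [histCost]
    refine le_min (ih fun l hl => ?_) ?_
    · rw [← hρ l (by simp; omega), List.reverse_cons, List.getD_append _ _ _ _ (by simpa)]
    · split_ifs with hw
      · have := hρ h.length (by simp)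
        rw [List.reverse_cons, List.getD_append_right _ _ _ _ (by simp)] at this
        refine iInf₂_le h.length ?_
        simp only [List.length_reverse, Nat.sub_self, List.getD_cons_zero] at this
        rwa [Set.mem_ofPred_eq, ← this]
      · exact le_top

lemma histCost_le (G : QRGame ι V) (v₀ : V) (i : ι) (h : List V) (l : ℕ) (hl : l < h.length)
    (hF : h.reverse.getD l v₀ ∈ G.F i) : G.histCost i h ≤ l := by
  induction h with
  | nil => simp at hl
  | cons w h ih =>
    rw [List.reverse_cons] at hF
    rcases Nat.lt_or_ge l h.length with hl' | hl'
    · rw [List.getD_append _ _ _ _ (by simpa)] at hF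
      exact (G.histCost_cons_le i w h).trans (ih hl' hF)
    · obtain rfl : l = h.length := by simp at hl; omega
      rw [List.getD_append_right _ _ _ _ (by simp)] at hF
      simp only [List.length_reverse, Nat.sub_self, List.getD_cons_zero] at hF
      simp [histCost, hF]

lemma exists_cost_eq (G : QRGame ι V) (i : ι) (ρ : ℕ → V) (hρ : G.cost i ρ ≠ ⊤) :
    ∃ l : ℕ, ρ l ∈ G.F i ∧ G.cost i ρ = l := by
  obtain ⟨m, hm⟩ := ENat.ne_top_iff_exists.mp hρ
  have hlt : G.cost i ρ < (m + 1 : ℕ) := by rw [← hm]; exact_mod_cast Nat.lt_succ_self m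
  obtain ⟨l, hl, hlm⟩ : ∃ l : ℕ, ρ l ∈ G.F i ∧ (l : ℕ∞) < (m + 1 : ℕ) := by
    simpa [cost, iInf_lt_iff] using hlt
  have hle : G.cost i ρ ≤ l := iInf₂_le l hl
  refine ⟨l, hl, le_antisymm hle ?_⟩
  rw [← hm]
  norm_cast at hlm ⊢
  omega

lemma length_histFrom (G : QRGame ι V) (v₀ : V) (σ : ι → List V → V) (h : List V) (t : ℕ) :
    (G.histFrom v₀ σ h t).length = h.length + t := by
  induction t with
  | zero => rfl
  | succ t ih => simp [histFrom, ih]; omega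

lemma getD_histFrom_of_le (G : QRGame ι V) (v₀ : V) (σ : ι → List V → V) (h : List V)
    {s t l : ℕ} (hst : s ≤ t) (hl : l < h.length + s) :
    (G.histFrom v₀ σ h t).reverse.getD l v₀ = (G.histFrom v₀ σ h s).reverse.getD l v₀ := by
  induction t, hst using Nat.le_induction with
  | base => rfl
  | succ t hst ih =>
    rw [histFrom, List.reverse_cons, List.getD_append _ _ _ _ _, ih]
    rw [List.length_reverse, length_histFrom]
    omega

lemma getD_histFrom (G : QRGame ι V) (v₀ : V) (σ : ι → List V → V) (h : List V) (hh : h ≠ [])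
    {t l : ℕ} (hl : l < h.length + t) :
    (G.histFrom v₀ σ h t).reverse.getD l v₀ = G.fullPlay v₀ σ h l := by
  have hpos := List.length_pos_iff.mpr hh
  rcases le_total l t with hlt | hlt
  · exact G.getD_histFrom_of_le v₀ σ h hlt (by omega)
  · exact (G.getD_histFrom_of_le v₀ σ h hlt hl).symm

lemma cost_fullPlay_le (G : QRGame ι V) (v₀ : V) (σ : ι → List V → V) (h : List V) (hh : h ≠ [])
    (i : ι) (t : ℕ) :
    G.cost i (G.fullPlay v₀ σ h) ≤ G.histCost i (G.histFrom v₀ σ h t) := by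
  refine G.cost_le_histCost v₀ i _ _ fun l hl => G.getD_histFrom v₀ σ h hh ?_
  rwa [length_histFrom] at hl

lemma exists_histCost_eq_cost (G : QRGame ι V) (v₀ : V) (σ : ι → List V → V) (h : List V)
    (hh : h ≠ []) (i : ι) (hc : G.cost i (G.fullPlay v₀ σ h) ≠ ⊤) :
    ∃ t, ∀ s, t ≤ s →
      G.histCost i (G.histFrom v₀ σ h s) = G.cost i (G.fullPlay v₀ σ h) := by
  obtain ⟨l, hl, hlc⟩ := G.exists_cost_eq i _ hc
  have hpos := List.length_pos_iff.mpr hh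
  refine ⟨l, fun s hs => le_antisymm ?_ (G.cost_fullPlay_le v₀ σ h hh i s)⟩
  rw [hlc]
  refine G.histCost_le v₀ i _ l (by rw [length_histFrom]; omega) ?_
  rwa [G.getD_histFrom v₀ σ h hh (by omega)]

lemma isHist_histFrom (G : QRGame ι V) (v₀ : V) (σ : ι → List V → V) (hσ : G.IsProfile v₀ σ)
    (h : List V) (hh : G.IsHist v₀ h) (t : ℕ) : G.IsHist v₀ (G.histFrom v₀ σ h t) := by
  induction t with
  | zero => exact hh
  | succ t ih =>
    have hE := hσ _ _ ih rfl
    rw [histFrom]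
    generalize G.histFrom v₀ σ h t = h' at ih hE ⊢
    cases h' with
    | nil => exact ih.elim
    | cons w h' => exact ⟨hE, ih⟩

end Auxiliary

section TwoPlayer

variable {V : Type}

/-- Player `j` minimises this key: first the own cost, then the opposite of the other cost. -/
def prefKey (j : Fin 2) (x : Fin 2 → ℕ∞) : ℕ∞ ×ₗ ℕ∞ᵒᵈ :=
  toLex (x j, OrderDual.toDual (x (1 - j)))

lemma prefKey_le_iff (j : Fin 2) (x y : Fin 2 → ℕ∞) :
    prefKey j x ≤ prefKey j y ↔ x j < y j ∨ (x j = y j ∧ y (1 - j) ≤ x (1 - j)) := by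
  simp [prefKey, Prod.Lex.toLex_le_toLex]

lemma le_of_prefKey_le {j : Fin 2} {x y : Fin 2 → ℕ∞} (h : prefKey j x ≤ prefKey j y) :
    x j ≤ y j := by
  rcases (prefKey_le_iff j x y).mp h with h | h
  · exact h.le
  · exact h.1.le

lemma eq_one_sub_of_ne {i j : Fin 2} (h : i ≠ j) : i = 1 - j := by
  omega

lemma isProfile_update {G : QRGame (Fin 2) V} {v₀ : V} {σ : Fin 2 → List V → V}
    (hσ : G.IsProfile v₀ σ) {j : Fin 2} {σ' : List V → V} (hσ' : G.IsStrat v₀ j σ') :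
    G.IsProfile v₀ (Function.update σ j σ') := by
  intro i
  by_cases hij : i = j
  · subst hij
    simpa using hσ'
  · simpa [hij] using hσ i

variable [Fintype V]

lemma exists_best_succ (G : QRGame (Fin 2) V) (v : V) (f : V → Fin 2 → ℕ∞) :
    ∃ w, G.E v w ∧ ∀ w', G.E v w' →
      prefKey (G.owner v) (f w) ≤ prefKey (G.owner v) (f w') :=
  Set.exists_min_image {w | G.E v w} (fun w => prefKey (G.owner v) (f w)) (Set.toFinite _)
    (G.total v)

/-- The successor of `v` that its owner prefers when moving to `w` yields the costs `f w`. -/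
noncomputable def bestSucc (G : QRGame (Fin 2) V) (v : V) (f : V → Fin 2 → ℕ∞) : V :=
  (G.exists_best_succ v f).choose

lemma edge_bestSucc (G : QRGame (Fin 2) V) (v : V) (f : V → Fin 2 → ℕ∞) :
    G.E v (G.bestSucc v f) :=
  (G.exists_best_succ v f).choose_spec.1

lemma bestSucc_le (G : QRGame (Fin 2) V) (v : V) (f : V → Fin 2 → ℕ∞) {w : V}
    (hw : G.E v w) :
    prefKey (G.owner v) (f (G.bestSucc v f)) ≤ prefKey (G.owner v) (f w) :=
  (G.exists_best_succ v f).choose_spec.2 w hw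

/-- Backward induction cost profile after `h` when `k` steps remain to be played. -/
noncomputable def truncValue (G : QRGame (Fin 2) V) (v₀ : V) : ℕ → List V → Fin 2 → ℕ∞
  | 0, h => fun i => G.histCost i h
  | k + 1, h =>
      truncValue G v₀ k (G.bestSucc (cur v₀ h) (fun w => truncValue G v₀ k (w :: h)) :: h)

/-- Backward induction choice after `h` when `k + 1` steps remain to be played. -/
noncomputable def truncMove (G : QRGame (Fin 2) V) (v₀ : V) (k : ℕ) (h : List V) : V :=
  G.bestSucc (cur v₀ h) (fun w => G.truncValue v₀ k (w :: h))

lemma truncValue_succ (G : QRGame (Fin 2) V) (v₀ : V) (k : ℕ) (h : List V) :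
    G.truncValue v₀ (k + 1) h = G.truncValue v₀ k (G.truncMove v₀ k h :: h) :=
  rfl

lemma prefKey_truncValue_le (G : QRGame (Fin 2) V) (v₀ : V) (k : ℕ) (h : List V) {w : V}
    (hw : G.E (cur v₀ h) w) :
    prefKey (G.owner (cur v₀ h)) (G.truncValue v₀ (k + 1) h) ≤
      prefKey (G.owner (cur v₀ h)) (G.truncValue v₀ k (w :: h)) :=
  G.bestSucc_le (cur v₀ h) (fun w => G.truncValue v₀ k (w :: h)) hw

lemma truncValue_le_histCost (G : QRGame (Fin 2) V) (v₀ : V) (k : ℕ) (h : List V) (i : Fin 2) :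
    G.truncValue v₀ k h i ≤ G.histCost i h := by
  induction k generalizing h with
  | zero => exact le_rfl
  | succ k ih => exact (ih _).trans (G.histCost_cons_le i _ h)

lemma min_histCost_length_le_truncValue (G : QRGame (Fin 2) V) (v₀ : V) (k : ℕ) (h : List V)
    (i : Fin 2) : min (G.histCost i h) h.length ≤ G.truncValue v₀ k h i := by
  induction k generalizing h with
  | zero => exact min_le_left _ _
  | succ k ih =>
    rw [truncValue_succ]
    refine le_trans (le_min (G.min_histCost_length_le_cons i _ h) ?_) (ih _)
    refine (min_le_right _ _).trans ?_
    exact_mod_cast Nat.le_succ _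

lemma truncValue_eq_histCost (G : QRGame (Fin 2) V) (v₀ : V) (k : ℕ) (h : List V) (i : Fin 2)
    (hi : G.histCost i h ≠ ⊤) : G.truncValue v₀ k h i = G.histCost i h := by
  refine le_antisymm (G.truncValue_le_histCost v₀ k h i) ?_
  have := G.min_histCost_length_le_truncValue v₀ k h i
  rwa [min_eq_left (G.histCost_lt_length i h hi).le] at this

/-- Once the opponent of `j` has reached the goal set, more time can only help player `j`. -/
lemma truncValue_succ_le (G : QRGame (Fin 2) V) (v₀ : V) (j : Fin 2) (k : ℕ) (h : List V)
    (hh : G.histCost (1 - j) h ≠ ⊤) :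
    G.truncValue v₀ (k + 1) h j ≤ G.truncValue v₀ k h j := by
  induction k generalizing h with
  | zero => exact G.truncValue_le_histCost v₀ 1 h j
  | succ k ih =>
    have hcons : ∀ w, G.histCost (1 - j) (w :: h) ≠ ⊤ := fun w => by
      rwa [G.histCost_cons_eq _ w h hh]
    by_cases ho : G.owner (cur v₀ h) = j
    · have := G.prefKey_truncValue_le v₀ (k + 1) h (w := G.truncMove v₀ k h)
        (G.edge_bestSucc _ _)
      rw [ho] at this
      exact (le_of_prefKey_le this).trans (ih _ (hcons _))
    · have hmove : G.E (cur v₀ h) (G.truncMove v₀ (k + 1) h) := G.edge_bestSucc _ _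
      have := G.prefKey_truncValue_le v₀ k h hmove
      rw [eq_one_sub_of_ne ho, prefKey_le_iff] at this
      rw [G.truncValue_succ v₀ (k + 1)]
      refine (ih _ (hcons _)).trans ?_
      rw [G.truncValue_eq_histCost v₀ _ h _ hh, G.truncValue_eq_histCost v₀ _ _ _ (hcons _),
        G.histCost_cons_eq _ _ h hh] at this
      simpa using this

lemma exists_eventually_move (G : QRGame (Fin 2) V) (v₀ : V) (h : List V) :
    ∃ w, ∀ᶠ n in (Filter.hyperfilter ℕ : Filter ℕ),
      G.truncMove v₀ (n - (h.length + 1)) h = w := by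
  obtain ⟨w, hw⟩ := ((Filter.hyperfilter ℕ).map
    fun n => G.truncMove v₀ (n - (h.length + 1)) h).eq_pure_of_finite
  refine ⟨w, ?_⟩
  have : ({w} : Set V) ∈ (Filter.hyperfilter ℕ).map
      fun n => G.truncMove v₀ (n - (h.length + 1)) h := by
    rw [hw]; exact Set.mem_singleton w
  exact this

/-- The limit, along an ultrafilter, of the backward induction strategies of the truncated
games. -/
noncomputable def limitMove (G : QRGame (Fin 2) V) (v₀ : V) (h : List V) : V :=
  (G.exists_eventually_move v₀ h).choose

lemma eventually_truncMove_eq (G : QRGame (Fin 2) V) (v₀ : V) (h : List V) :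
    ∀ᶠ n in (Filter.hyperfilter ℕ : Filter ℕ),
      G.truncMove v₀ (n - (h.length + 1)) h = G.limitMove v₀ h :=
  (G.exists_eventually_move v₀ h).choose_spec

lemma edge_limitMove (G : QRGame (Fin 2) V) (v₀ : V) (h : List V) :
    G.E (cur v₀ h) (G.limitMove v₀ h) := by
  obtain ⟨n, hn⟩ := (G.eventually_truncMove_eq v₀ h).exists
  rw [← hn]
  exact G.edge_bestSucc _ _

/-- Backward induction cost profile after `h` in the game truncated after `n` vertices. -/
noncomputable def horizonValue (G : QRGame (Fin 2) V) (v₀ : V) (n : ℕ) (h : List V) :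
    Fin 2 → ℕ∞ :=
  G.truncValue v₀ (n - h.length) h

lemma eventually_hyperfilter_ge (m : ℕ) :
    ∀ᶠ n in (Filter.hyperfilter ℕ : Filter ℕ), m ≤ n :=
  Filter.Eventually.filter_mono
    (Filter.hyperfilter_le_cofinite.trans Nat.cofinite_eq_atTop.le) (Filter.eventually_ge_atTop m)

lemma eventually_horizonValue_limitMove (G : QRGame (Fin 2) V) (v₀ : V) (h : List V) :
    ∀ᶠ n in (Filter.hyperfilter ℕ : Filter ℕ),
      G.horizonValue v₀ n h = G.horizonValue v₀ n (G.limitMove v₀ h :: h) := by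
  filter_upwards [G.eventually_truncMove_eq v₀ h, eventually_hyperfilter_ge (h.length + 1)]
    with n hn hle
  obtain ⟨k, rfl⟩ := Nat.exists_eq_add_of_le hle
  have h₁ : h.length + 1 + k - h.length = k + 1 := by omega
  have h₂ : h.length + 1 + k - (h.length + 1) = k := by omega
  rw [h₂] at hn
  rw [horizonValue, horizonValue, List.length_cons, h₁, h₂, truncValue_succ, hn]

lemma eventually_prefKey_horizonValue_le (G : QRGame (Fin 2) V) (v₀ : V) (h : List V) {w : V}
    (hw : G.E (cur v₀ h) w) :
    ∀ᶠ n in (Filter.hyperfilter ℕ : Filter ℕ),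
      prefKey (G.owner (cur v₀ h)) (G.horizonValue v₀ n h) ≤
        prefKey (G.owner (cur v₀ h)) (G.horizonValue v₀ n (w :: h)) := by
  filter_upwards [eventually_hyperfilter_ge (h.length + 1)] with n hle
  obtain ⟨k, rfl⟩ := Nat.exists_eq_add_of_le hle
  have h₁ : h.length + 1 + k - h.length = k + 1 := by omega
  have h₂ : h.length + 1 + k - (h.length + 1) = k := by omega
  rw [horizonValue, horizonValue, List.length_cons, h₁, h₂]
  exact G.prefKey_truncValue_le v₀ k h hw

/-- The profile in which both players follow `limitMove`. -/
noncomputable def limitProfile (G : QRGame (Fin 2) V) (v₀ : V) : Fin 2 → List V → V :=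
  fun _ => G.limitMove v₀

lemma isProfile_limitProfile (G : QRGame (Fin 2) V) (v₀ : V) :
    G.IsProfile v₀ (G.limitProfile v₀) :=
  fun _ h _ _ => G.edge_limitMove v₀ h

lemma eventually_horizonValue_histFrom (G : QRGame (Fin 2) V) (v₀ : V) (h : List V) (t : ℕ) :
    ∀ᶠ n in (Filter.hyperfilter ℕ : Filter ℕ), G.horizonValue v₀ n h =
      G.horizonValue v₀ n (G.histFrom v₀ (G.limitProfile v₀) h t) := by
  induction t with
  | zero => exact Filter.Eventually.of_forall fun _ => rfl
  | succ t ih =>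
    filter_upwards [ih, G.eventually_horizonValue_limitMove v₀
      (G.histFrom v₀ (G.limitProfile v₀) h t)] with n h₁ h₂
    exact h₁.trans h₂

lemma eventually_prefKey_le_deviation (G : QRGame (Fin 2) V) (v₀ : V) (h : List V)
    (hh : G.IsHist v₀ h) (j : Fin 2) (σ' : List V → V) (hσ' : G.IsStrat v₀ j σ') (t : ℕ) :
    ∀ᶠ n in (Filter.hyperfilter ℕ : Filter ℕ),
      prefKey j (G.horizonValue v₀ n h) ≤ prefKey j (G.horizonValue v₀ n
        (G.histFrom v₀ (Function.update (G.limitProfile v₀) j σ') h t)) := by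
  induction t with
  | zero => exact Filter.Eventually.of_forall fun _ => le_rfl
  | succ t ih =>
    have hprof := isProfile_update (G.isProfile_limitProfile v₀) hσ'
    have hhist := G.isHist_histFrom v₀ _ hprof h hh t
    rw [histFrom]
    generalize G.histFrom v₀ (Function.update (G.limitProfile v₀) j σ') h t = d at ih hhist ⊢
    by_cases ho : G.owner (cur v₀ d) = j
    · filter_upwards [ih, G.eventually_prefKey_horizonValue_le v₀ d (hprof _ d hhist rfl)]
        with n h₁ h₂
      rw [ho] at h₂ ⊢
      exact h₁.trans h₂
    · filter_upwards [ih, G.eventually_horizonValue_limitMove v₀ d] with n h₁ h₂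
      rw [Function.update_of_ne ho]
      rw [h₂] at h₁
      exact h₁

lemma min_cost_length_le_horizonValue (G : QRGame (Fin 2) V) (v₀ : V) (σ : Fin 2 → List V → V)
    (h : List V) (hh : h ≠ []) (i : Fin 2) (t n : ℕ) :
    min (G.cost i (G.fullPlay v₀ σ h)) t ≤
      G.horizonValue v₀ n (G.histFrom v₀ σ h t) i := by
  refine le_trans (min_le_min (G.cost_fullPlay_le v₀ σ h hh i t) ?_)
    (G.min_histCost_length_le_truncValue v₀ _ _ i)
  rw [length_histFrom]
  exact_mod_cast Nat.le_add_left _ _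

lemma exists_horizonValue_eq_cost (G : QRGame (Fin 2) V) (v₀ : V) (σ : Fin 2 → List V → V)
    (h : List V) (hh : h ≠ []) (i : Fin 2) (hc : G.cost i (G.fullPlay v₀ σ h) ≠ ⊤) :
    ∃ t, ∀ s, t ≤ s → ∀ n, G.horizonValue v₀ n (G.histFrom v₀ σ h s) i =
      G.cost i (G.fullPlay v₀ σ h) := by
  obtain ⟨t, ht⟩ := G.exists_histCost_eq_cost v₀ σ h hh i hc
  refine ⟨t, fun s hs n => ?_⟩
  rw [horizonValue, truncValue_eq_histCost _ _ _ _ _ (by rwa [ht s hs]), ht s hs]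

lemma eventually_horizonValue_eq_cost (G : QRGame (Fin 2) V) (v₀ : V) (h : List V) (hh : h ≠ [])
    (i : Fin 2) (hc : G.cost i (G.fullPlay v₀ (G.limitProfile v₀) h) ≠ ⊤) :
    ∀ᶠ n in (Filter.hyperfilter ℕ : Filter ℕ),
      G.horizonValue v₀ n h i = G.cost i (G.fullPlay v₀ (G.limitProfile v₀) h) := by
  obtain ⟨t, ht⟩ := G.exists_horizonValue_eq_cost v₀ _ h hh i hc
  filter_upwards [G.eventually_horizonValue_histFrom v₀ h t] with n hn
  rw [hn, ht t le_rfl]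

lemma eventually_lt_horizonValue (G : QRGame (Fin 2) V) (v₀ : V) (h : List V) (hh : h ≠ [])
    (i : Fin 2) (m : ℕ) (hm : (m : ℕ∞) < G.cost i (G.fullPlay v₀ (G.limitProfile v₀) h)) :
    ∀ᶠ n in (Filter.hyperfilter ℕ : Filter ℕ), (m : ℕ∞) < G.horizonValue v₀ n h i := by
  filter_upwards [G.eventually_horizonValue_histFrom v₀ h (m + 1)] with n hn
  rw [hn]
  refine lt_of_lt_of_le (lt_min hm ?_) (G.min_cost_length_le_horizonValue v₀ _ h hh i (m + 1) n)
  exact_mod_cast Nat.lt_succ_self m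

/-- If `j` never reaches the goal set in the limit although the opponent does, then `j` does not
reach it in the truncated games either. -/
lemma eventually_horizonValue_eq_top (G : QRGame (Fin 2) V) (v₀ : V) (h : List V) (hh : h ≠ [])
    (j : Fin 2) (hj : G.cost j (G.fullPlay v₀ (G.limitProfile v₀) h) = ⊤)
    (hj' : G.cost (1 - j) (G.fullPlay v₀ (G.limitProfile v₀) h) ≠ ⊤) :
    ∀ᶠ n in (Filter.hyperfilter ℕ : Filter ℕ), G.horizonValue v₀ n h j = ⊤ := by
  obtain ⟨T, hT⟩ := G.exists_histCost_eq_cost v₀ _ h hh (1 - j) hj'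
  have hr : G.histCost (1 - j) (G.histFrom v₀ (G.limitProfile v₀) h T) ≠ ⊤ := by
    rwa [hT T le_rfl]
  have hev := G.eventually_horizonValue_histFrom v₀ h T
  generalize G.histFrom v₀ (G.limitProfile v₀) h T = r at hr hev
  have hanti : Antitone fun k => G.truncValue v₀ k r j :=
    antitone_nat_of_succ_le fun k => G.truncValue_succ_le v₀ j k r hr
  have htop : ∀ k, G.truncValue v₀ k r j = ⊤ := by
    intro k
    by_contra hk
    obtain ⟨m, hm⟩ := ENat.ne_top_iff_exists.mp hk
    obtain ⟨n, h₁, h₂, h₃⟩ := (hev.and ((eventually_hyperfilter_ge (r.length + k)).and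
      (G.eventually_lt_horizonValue v₀ h hh j m (by rw [hj]; exact ENat.natCast_lt_top m)))).exists
    rw [h₁, hm] at h₃
    exact absurd (hanti (show k ≤ n - r.length by omega)) (not_le.mpr h₃)
  filter_upwards [hev] with n hn
  rw [hn]
  exact htop _

lemma isSPSE_limitProfile (G : QRGame (Fin 2) V) (v₀ : V) :
    G.IsSPSE v₀ (G.limitProfile v₀) := by
  rintro h hh ⟨j, σ', hσ', hprec⟩
  have hne : h ≠ [] := by
    rintro rfl
    exact hh
  have hdev := G.eventually_prefKey_le_deviation v₀ h hh j σ' hσ'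
  set τ := Function.update (G.limitProfile v₀) j σ'
  rcases hprec with hlt | ⟨heq, hle, i, hi⟩
  · dsimp only at hlt
    obtain ⟨m, hm⟩ := ENat.ne_top_iff_exists.mp hlt.ne_top
    obtain ⟨t, ht⟩ := G.exists_horizonValue_eq_cost v₀ τ h hne j hlt.ne_top
    obtain ⟨n, h₁, h₂⟩ := ((hdev t).and
      (G.eventually_lt_horizonValue v₀ h hne j m (by rw [hm]; exact hlt))).exists
    have := le_of_prefKey_le h₁
    rw [ht t le_rfl, ← hm] at this
    exact absurd this (not_le.mpr h₂)
  · have hij : i ≠ j := by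
      rintro rfl
      exact hi.ne heq
    obtain rfl := eq_one_sub_of_ne hij
    dsimp only at heq hi
    have hxc := G.eventually_horizonValue_eq_cost v₀ h hne (1 - j) hi.ne_top
    obtain ⟨m, hm⟩ := ENat.ne_top_iff_exists.mp hi.ne_top
    have hother : ∀ t, m + 1 ≤ t → ∀ n, (m : ℕ∞) <
        G.horizonValue v₀ n (G.histFrom v₀ τ h t) (1 - j) := by
      intro t ht n
      refine lt_of_lt_of_le (lt_min (by rwa [hm]) ?_)
        (G.min_cost_length_le_horizonValue v₀ τ h hne (1 - j) t n)
      exact_mod_cast ht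
    obtain ⟨t, hmt, hown⟩ : ∃ t, m + 1 ≤ t ∧ ∀ᶠ n in (Filter.hyperfilter ℕ : Filter ℕ),
        G.horizonValue v₀ n (G.histFrom v₀ τ h t) j ≤ G.horizonValue v₀ n h j := by
      by_cases hx : G.cost j (G.fullPlay v₀ (G.limitProfile v₀) h) = ⊤
      · refine ⟨m + 1, le_rfl, ?_⟩
        filter_upwards [G.eventually_horizonValue_eq_top v₀ h hne j hx hi.ne_top] with n hn
        rw [hn]
        exact le_top
      · obtain ⟨t, ht⟩ := G.exists_horizonValue_eq_cost v₀ τ h hne j (by rwa [← heq])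
        refine ⟨max t (m + 1), le_max_right _ _, ?_⟩
        filter_upwards [G.eventually_horizonValue_eq_cost v₀ h hne j hx] with n hn
        rw [hn, ht _ (le_max_left _ _), heq]
    obtain ⟨n, h₁, h₂, h₃⟩ := ((hdev t).and (hown.and hxc)).exists
    rcases (prefKey_le_iff _ _ _).mp h₁ with h₄ | ⟨-, h₄⟩
    · exact absurd h₂ (not_le.mpr h₄)
    · rw [h₃, ← hm] at h₄
      exact absurd h₄ (not_le.mpr (hother t hmt n))

end TwoPlayer

end QRGame

/-- In every two-player quantitative reachability game, there exists a subgame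
perfect secure equilibrium. -/
theorem exists_subgame_perfect_secure_equilibrium_two_player
    {V : Type} [Fintype V]
    (G : QRGame (Fin 2) V) (v₀ : V) :
    ∃ σ : Fin 2 → List V → V, G.IsProfile v₀ σ ∧ G.IsSPSE v₀ σ := by
  exact ⟨G.limitProfile v₀, G.isProfile_limitProfile v₀, G.isSPSE_limitProfile v₀⟩
end

section
/- If there exists a secure equilibrium in a multiplayer quantitative reachability game (G, v₀), then there exists a secure equilibrium in (G, v₀) that is finite-memory. -/
open scoped Classical ENat

namespace QRGame

variable {ι V : Type}

/-- A strategy is finite-memory if the equivalence relation identifying two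
histories `h`, `h'` whenever `σ` answers the same on `hδ` and `h'δ` for every
continuation `δ` has finite index; equivalently, the map sending a history to
the induced answering function has finite range.  (Histories are reversed
lists, so the continuation `δ` is appended in front.) -/
def FinMem (σ : List V → V) : Prop :=
  (Set.range fun h : List V => fun δ : List V => σ (δ ++ h)).Finite

end QRGame

namespace QRGame

variable {ι V : Type}

/-! ### Plays and their initial histories -/

/-- The (reversed) list of the first `n` vertices of `ρ`. -/
def initHist (ρ : ℕ → V) : ℕ → List V
  | 0 => []
  | n + 1 => ρ n :: initHist ρ n

@[simp] lemma length_initHist (ρ : ℕ → V) (n : ℕ) : (initHist ρ n).length = n := by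
  induction n with
  | zero => rfl
  | succ n ih => simp [initHist, ih]

lemma mem_initHist {ρ : ℕ → V} {n : ℕ} {v : V} : v ∈ initHist ρ n ↔ ∃ l < n, ρ l = v := by
  induction n with
  | zero => simp [initHist]
  | succ n ih =>
    simp only [initHist, List.mem_cons, ih, Nat.lt_succ_iff_lt_or_eq]
    grind

lemma getElem?_reverse_initHist {ρ : ℕ → V} {n l : ℕ} (h : l < n) :
    (initHist ρ n).reverse[l]? = some (ρ l) := by
  induction n with
  | zero => omega
  | succ n ih =>
    rw [initHist, List.reverse_cons]
    rcases Nat.lt_succ_iff_lt_or_eq.1 h with h | rfl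
    · rw [List.getElem?_append_left (by simpa using h), ih h]
    · rw [List.getElem?_append_right (by simp)]
      simp

lemma initHist_congr {ρ ρ' : ℕ → V} {n : ℕ} (h : ∀ t < n, ρ t = ρ' t) :
    initHist ρ n = initHist ρ' n := by
  induction n with
  | zero => rfl
  | succ n ih => simp [initHist, h n (by omega), ih fun t ht => h t (by omega)]

@[simp] lemma cur_initHist_succ (v₀ : V) (ρ : ℕ → V) (n : ℕ) :
    cur v₀ (initHist ρ (n + 1)) = ρ n := rfl

/-- `ρ` is an infinite path of the graph starting at `v₀`. -/
def IsPlay (G : QRGame ι V) (v₀ : V) (ρ : ℕ → V) : Prop :=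
  ρ 0 = v₀ ∧ ∀ t, G.E (ρ t) (ρ (t + 1))

/-- The move of `ρ` at time `t` is the one of `σ`, unless it is made by player `j`. -/
def ConsistentAt (G : QRGame ι V) (σ : ι → List V → V) (j : ι) (ρ : ℕ → V) (t : ℕ) : Prop :=
  G.owner (ρ t) ≠ j → ρ (t + 1) = σ (G.owner (ρ t)) (initHist ρ (t + 1))

lemma IsHist.cons {G : QRGame ι V} {v₀ v : V} {h : List V} (hh : G.IsHist v₀ h)
    (hE : G.E (cur v₀ h) v) : G.IsHist v₀ (v :: h) := by
  cases h with
  | nil => exact hh.elim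
  | cons w t => exact ⟨hE, hh⟩

lemma IsHist.ne_nil {G : QRGame ι V} {v₀ : V} {h : List V} (hh : G.IsHist v₀ h) : h ≠ [] := by
  rintro rfl
  exact hh

lemma isPlay_of_isHist {G : QRGame ι V} {v₀ : V} {ρ : ℕ → V} {n : ℕ}
    (hh : G.IsHist v₀ (initHist ρ (n + 1))) (hE : ∀ t, n ≤ t → G.E (ρ t) (ρ (t + 1))) :
    G.IsPlay v₀ ρ := by
  induction n with
  | zero => exact ⟨hh, fun t => hE t (Nat.zero_le t)⟩
  | succ n ih =>
    obtain ⟨he, hh⟩ := hh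
    refine ih hh fun t ht => ?_
    rcases ht.eq_or_lt with rfl | ht
    · exact he
    · exact hE t ht

/-! ### Outcomes of profiles -/

lemma histFrom_eq_initHist {G : QRGame ι V} {v₀ : V} {σ : ι → List V → V} {ρ : ℕ → V}
    (h0 : ρ 0 = v₀) (hs : ∀ t, ρ (t + 1) = σ (G.owner (ρ t)) (initHist ρ (t + 1))) (n : ℕ) :
    G.histFrom v₀ σ [v₀] n = initHist ρ (n + 1) := by
  induction n with
  | zero => simp [histFrom, initHist, h0]
  | succ n ih => rw [histFrom, ih, cur_initHist_succ, ← hs, ← initHist]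

lemma fullPlay_eq {G : QRGame ι V} {v₀ : V} {σ : ι → List V → V} {ρ : ℕ → V}
    (h0 : ρ 0 = v₀) (hs : ∀ t, ρ (t + 1) = σ (G.owner (ρ t)) (initHist ρ (t + 1))) :
    G.fullPlay v₀ σ [v₀] = ρ := by
  funext t
  rw [fullPlay, histFrom_eq_initHist h0 hs, List.getD_eq_getElem?_getD,
    getElem?_reverse_initHist (Nat.lt_succ_self t)]
  rfl

lemma exists_outcome (G : QRGame ι V) (v₀ : V) (σ : ι → List V → V) :
    ∃ ρ : ℕ → V, ρ 0 = v₀ ∧ ∀ t, ρ (t + 1) = σ (G.owner (ρ t)) (initHist ρ (t + 1)) := by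
  let ρ : ℕ → V := fun t => cur v₀ (G.histFrom v₀ σ [v₀] t)
  have hh : ∀ n, G.histFrom v₀ σ [v₀] n = initHist ρ (n + 1) := by
    intro n
    induction n with
    | zero => rfl
    | succ n ih =>
      rw [initHist, ← ih]
      rfl
  refine ⟨ρ, rfl, fun t => ?_⟩
  rw [← hh]
  rfl

lemma isPlay_of_isProfile {G : QRGame ι V} {v₀ : V} {σ : ι → List V → V} {ρ : ℕ → V}
    (hσ : G.IsProfile v₀ σ) (h0 : ρ 0 = v₀)
    (hs : ∀ t, ρ (t + 1) = σ (G.owner (ρ t)) (initHist ρ (t + 1))) : G.IsPlay v₀ ρ := by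
  have hh : ∀ n, G.IsHist v₀ (initHist ρ (n + 1)) ∧ G.E (ρ n) (ρ (n + 1)) := by
    intro n
    induction n with
    | zero =>
      refine ⟨h0, ?_⟩
      rw [hs]
      exact hσ (G.owner (ρ 0)) (initHist ρ 1) h0 rfl
    | succ n ih =>
      have := ih.1.cons (v := ρ (n + 1)) ih.2
      refine ⟨this, ?_⟩
      rw [hs (n + 1)]
      exact hσ (G.owner (ρ (n + 1))) (initHist ρ (n + 2)) this rfl
  exact ⟨h0, fun t => (hh t).2⟩

/-- A secure equilibrium resists every play in which a single player deviates. -/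
lemma IsSecure.not_prec [DecidableEq ι] {G : QRGame ι V} {v₀ : V} {σ : ι → List V → V}
    (hσ : G.IsProfile v₀ σ) (hsec : G.IsSecure v₀ σ) {j : ι} {ρ : ℕ → V}
    (hρ : G.IsPlay v₀ ρ) (hc : ∀ t, G.ConsistentAt σ j ρ t) :
    ¬ Prec j (fun i => G.cost i (G.fullPlay v₀ σ [v₀])) (fun i => G.cost i ρ) := by
  intro hp
  refine hsec ⟨j, fun h => if h = initHist ρ h.length then ρ h.length else σ j h, ?_, ?_⟩
  · intro h hh ho
    beta_reduce
    split_ifs with he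
    · obtain ⟨n, hn⟩ := Nat.exists_eq_succ_of_ne_zero (mt List.length_eq_zero_iff.1 hh.ne_nil)
      rw [hn] at he
      rw [hn, he]
      exact hρ.2 n
    · exact hσ j h hh ho
  · have hplay := fullPlay_eq (G := G) (ρ := ρ) (σ := Function.update σ j
      fun h => if h = initHist ρ h.length then ρ h.length else σ j h) hρ.1 fun t => by
        by_cases ho : G.owner (ρ t) = j
        · rw [ho, Function.update_self]
          simp
        · rw [Function.update_of_ne ho]
          exact hc t ho
    rwa [hplay]

/-- A profile resisting every play in which a single player deviates is a secure equilibrium. -/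
lemma isSecure_of_not_prec [DecidableEq ι] {G : QRGame ι V} {v₀ : V} {σ : ι → List V → V}
    (hσ : G.IsProfile v₀ σ)
    (H : ∀ j ρ, G.IsPlay v₀ ρ → (∀ t, G.ConsistentAt σ j ρ t) →
      ¬ Prec j (fun i => G.cost i (G.fullPlay v₀ σ [v₀])) (fun i => G.cost i ρ)) :
    G.IsSecure v₀ σ := by
  rintro ⟨j, σ', hσ', hp⟩
  obtain ⟨ρ, h0, hs⟩ := exists_outcome G v₀ (Function.update σ j σ')
  rw [fullPlay_eq h0 hs] at hp
  refine H j ρ (isPlay_of_isProfile (fun i => ?_) h0 hs) (fun t ht => ?_) hp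
  · by_cases hi : i = j
    · subst hi
      rwa [Function.update_self]
    · rw [Function.update_of_ne hi]
      exact hσ i
  · rw [hs, Function.update_of_ne ht]

/-- Extending a history step by step to an infinite sequence. -/
lemma exists_extension {P : List V → Prop} {R : List V → V → Prop}
    (hstep : ∀ h, P h → ∃ v, R h v ∧ P (v :: h)) {h₀ : List V} (h₀P : P h₀) :
    ∃ ρ : ℕ → V, initHist ρ h₀.length = h₀ ∧
      ∀ t, h₀.length ≤ t → P (initHist ρ t) ∧ R (initHist ρ t) (ρ t) := by
  have hV : Nonempty V := ⟨(hstep h₀ h₀P).choose⟩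
  choose! f hf using hstep
  let H : ℕ → List V := fun n => Nat.rec h₀ (fun _ h => f h :: h) n
  have hHP : ∀ n, P (H n) := fun n => by
    induction n with
    | zero => exact h₀P
    | succ n ih => exact (hf _ ih).2
  let ρ : ℕ → V := fun t =>
    if ht : t < h₀.length then h₀.reverse[t]'(by simpa using ht) else f (H (t - h₀.length))
  have h1 : initHist ρ h₀.length = h₀ := by
    rw [← List.reverse_inj]
    apply List.ext_getElem?
    intro l
    by_cases hl : l < h₀.length
    · rw [getElem?_reverse_initHist hl]
      simp [ρ, hl]
    · rw [List.getElem?_eq_none (by simpa using hl), List.getElem?_eq_none (by simpa using hl)]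
  have h2 : ∀ n, initHist ρ (h₀.length + n) = H n := fun n => by
    induction n with
    | zero => exact h1
    | succ n ih =>
      rw [← add_assoc, initHist, ih]
      simp [ρ, H]
  refine ⟨ρ, h1, fun t ht => ?_⟩
  obtain ⟨n, rfl⟩ := Nat.exists_eq_add_of_le ht
  rw [h2]
  refine ⟨hHP n, ?_⟩
  have : ρ (h₀.length + n) = f (H n) := by simp [ρ]
  rw [this]
  exact (hf _ (hHP n)).1

/-! ### Costs -/

lemma cost_lt_iff {G : QRGame ι V} {i : ι} {ρ : ℕ → V} {a : ℕ∞} :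
    G.cost i ρ < a ↔ ∃ l : ℕ, (l : ℕ∞) < a ∧ ρ l ∈ G.F i := by
  simp only [cost, iInf_lt_iff, Set.mem_ofPred_eq]
  grind

lemma lt_cost_iff {G : QRGame ι V} {i : ι} {ρ : ℕ → V} {a : ℕ∞} :
    a < G.cost i ρ ↔ ∃ c : ℕ, a = c ∧ ∀ l ≤ c, ρ l ∉ G.F i := by
  cases a with
  | top => simp
  | coe c =>
    have : ((c : ℕ) : ℕ∞) < G.cost i ρ ↔ ¬ G.cost i ρ < ((c + 1 : ℕ) : ℕ∞) := by
      rw [not_lt, Nat.cast_add, Nat.cast_one, ENat.add_one_le_iff (ENat.natCast_ne_top c)]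
    rw [this, cost_lt_iff]
    simp only [Nat.cast_lt, Nat.lt_succ_iff, not_exists, not_and, Nat.cast_inj,
      exists_eq_left']

lemma prec_iff {j : ι} {x y : ι → ℕ∞} :
    Prec j x y ↔ y j < x j ∨ (¬ (∃ i, y i < x i) ∧ ¬ x j < y j ∧ ∃ i, x i < y i) := by
  unfold Prec
  push Not
  constructor
  · rintro (h | ⟨h, h', h''⟩)
    · exact Or.inl h
    · exact Or.inr ⟨h', h.ge, h''⟩
  · rintro (h | ⟨h, h', h''⟩)
    · exact Or.inl h
    · exact Or.inr ⟨le_antisymm (h j) h', h, h''⟩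

/-! ### Finite summaries of histories -/

/-- A summary of a history: its current vertex, its first vertices, and the set of players
whose goal has been visited. -/
abbrev Summary (ι V : Type) : Type := V × List V × Set ι

/-- Updating a summary when a vertex is visited. -/
def Summary.step (G : QRGame ι V) (N : ℕ) (v : V) (s : Summary ι V) : Summary ι V :=
  (v, (s.2.1 ++ [v]).take (N + 1), s.2.2 ∪ {i | v ∈ G.F i})

/-- The summary of a history, remembering its first `N + 1` vertices. -/
def summary (G : QRGame ι V) (v₀ : V) (N : ℕ) (h : List V) : Summary ι V :=
  h.foldr (Summary.step G N) (v₀, [], ∅)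

section Summary

variable {G : QRGame ι V} {v₀ : V} {N : ℕ}

lemma summary_cons (v : V) (h : List V) :
    G.summary v₀ N (v :: h) = (G.summary v₀ N h).step G N v := rfl

lemma summary_fst (h : List V) : (G.summary v₀ N h).1 = cur v₀ h := by
  cases h <;> rfl

lemma summary_take (h : List V) : (G.summary v₀ N h).2.1 = h.reverse.take (N + 1) := by
  induction h with
  | nil => rfl
  | cons v h ih =>
    rw [summary_cons, Summary.step, ih, List.reverse_cons]
    simp only [List.take_append, List.take_take, List.length_take, List.length_reverse]
    simp only [min_self]
    congr 2
    omega

lemma mem_summary {h : List V} {i : ι} :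
    i ∈ (G.summary v₀ N h).2.2 ↔ ∃ v ∈ h, v ∈ G.F i := by
  induction h with
  | nil => simp [summary]
  | cons v h ih =>
    simp only [summary_cons, Summary.step, Set.mem_union, ih, Set.mem_ofPred_eq, List.mem_cons,
      exists_eq_or_imp]
    exact or_comm

lemma finite_range_summary [Finite ι] [Finite V] : (Set.range (G.summary v₀ N)).Finite := by
  have hf := (Set.finite_univ (α := V)).prod
    ((List.finite_length_le V (N + 1)).prod (Set.finite_univ (α := Set ι)))
  refine hf.subset ?_
  rintro _ ⟨h, rfl⟩
  refine ⟨trivial, ?_, trivial⟩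
  rw [summary_take]
  simp

lemma getElem?_summary {ρ : ℕ → V} {t l : ℕ} {v : V} :
    (G.summary v₀ N (initHist ρ t)).2.1[l]? = some v ↔ l < t ∧ l ≤ N ∧ ρ l = v := by
  rw [summary_take, List.getElem?_take]
  split_ifs with h
  · by_cases hl : l < t
    · rw [getElem?_reverse_initHist hl]
      simp [hl, Nat.lt_succ_iff.1 h]
    · rw [List.getElem?_eq_none (by simpa using hl)]
      simp [hl]
  · simp
    omega

/-- According to the summary, the cost of player `i` is less than `x i`. -/
def Summary.Low (G : QRGame ι V) (x : ι → ℕ∞) (i : ι) (s : Summary ι V) : Prop :=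
  (∃ l : ℕ, (l : ℕ∞) < x i ∧ ∃ v ∈ G.F i, s.2.1[l]? = some v) ∨ (x i = ⊤ ∧ i ∈ s.2.2)

/-- According to the summary, the cost of player `i` is greater than `x i`. -/
def Summary.High (G : QRGame ι V) (x : ι → ℕ∞) (i : ι) (s : Summary ι V) : Prop :=
  ∃ c : ℕ, x i = c ∧ ∀ l ≤ c, ∀ v, s.2.1[l]? = some v → v ∉ G.F i

/-- The summary guarantees that player `j`, unless his cost gets smaller than `x j`,
does not obtain costs which he prefers to `x`. -/
def Summary.Done (G : QRGame ι V) (N : ℕ) (x : ι → ℕ∞) (j : ι) (s : Summary ι V) : Prop :=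
  (∃ i, s.Low G x i) ∨ (s.2.1.length = N + 1 ∧ (s.High G x j ∨ ∀ i, ¬ s.High G x i))

variable {x : ι → ℕ∞} {ρ : ℕ → V}

lemma cost_lt_of_low {i : ι} {t : ℕ} (h : (G.summary v₀ N (initHist ρ t)).Low G x i) :
    G.cost i ρ < x i := by
  rw [cost_lt_iff]
  rcases h with ⟨l, hl, v, hv, hlv⟩ | ⟨hx, hi⟩
  · rw [getElem?_summary] at hlv
    exact ⟨l, hl, hlv.2.2 ▸ hv⟩
  · obtain ⟨v, hv, hvF⟩ := mem_summary.1 hi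
    obtain ⟨l, -, rfl⟩ := mem_initHist.1 hv
    exact ⟨l, hx ▸ ENat.natCast_lt_top l, hvF⟩

lemma exists_forall_low (hN : ∀ i, x i = ⊤ ∨ x i ≤ N) {i : ι} (h : G.cost i ρ < x i) :
    ∃ T, ∀ t, T ≤ t → (G.summary v₀ N (initHist ρ t)).Low G x i := by
  obtain ⟨l, hl, hF⟩ := cost_lt_iff.1 h
  refine ⟨l + 1, fun t ht => ?_⟩
  rcases hN i with hi | hi
  · exact Or.inr ⟨hi, mem_summary.2 ⟨ρ l, mem_initHist.2 ⟨l, ht, rfl⟩, hF⟩⟩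
  · have : l < N := Nat.cast_lt.1 (hl.trans_le hi)
    exact Or.inl ⟨l, hl, ρ l, hF, getElem?_summary.2 ⟨ht, this.le, rfl⟩⟩

lemma high_iff (hN : ∀ i, x i = ⊤ ∨ x i ≤ N) {i : ι} {t : ℕ} (ht : N + 1 ≤ t) :
    (G.summary v₀ N (initHist ρ t)).High G x i ↔ x i < G.cost i ρ := by
  rw [lt_cost_iff, Summary.High]
  refine exists_congr fun c => and_congr_right fun hc => forall₂_congr fun l hl => ?_
  have hcN : c ≤ N := by
    rcases hN i with hi | hi
    · simp [hi] at hc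
    · exact Nat.cast_le.1 (hc ▸ hi)
  simp only [getElem?_summary]
  constructor
  · exact fun h => h _ ⟨by omega, by omega, rfl⟩
  · rintro h _ ⟨-, -, rfl⟩
    exact h

lemma length_summary {t : ℕ} :
    (G.summary v₀ N (initHist ρ t)).2.1.length = N + 1 ↔ N + 1 ≤ t := by
  rw [summary_take]
  simp

lemma exists_forall_done (hN : ∀ i, x i = ⊤ ∨ x i ≤ N) {j : ι}
    (h : ¬ Prec j x (fun i => G.cost i ρ)) :
    ∃ T, ∀ t, T ≤ t → (G.summary v₀ N (initHist ρ t)).Done G N x j := by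
  by_cases hl : ∃ i, G.cost i ρ < x i
  · obtain ⟨i, hi⟩ := hl
    obtain ⟨T, hT⟩ := exists_forall_low (v₀ := v₀) hN hi
    exact ⟨T, fun t ht => Or.inl ⟨i, hT t ht⟩⟩
  · refine ⟨N + 1, fun t ht => Or.inr ⟨length_summary.2 ht, ?_⟩⟩
    simp only [high_iff hN ht]
    rw [prec_iff] at h
    by_contra! hc
    exact h (Or.inr ⟨hl, not_lt.2 hc.1, hc.2⟩)

lemma not_prec_of_done (hN : ∀ i, x i = ⊤ ∨ x i ≤ N) {j : ι}
    (hd : ∃ t, (G.summary v₀ N (initHist ρ t)).Done G N x j)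
    (hl : ∃ T, ∀ t, T ≤ t → ¬ (G.summary v₀ N (initHist ρ t)).Low G x j) :
    ¬ Prec j x (fun i => G.cost i ρ) := by
  have hj : ¬ G.cost j ρ < x j := fun hlt => by
    obtain ⟨T, hT⟩ := hl
    obtain ⟨T', hT'⟩ := exists_forall_low (v₀ := v₀) hN hlt
    exact hT (max T T') (le_max_left _ _) (hT' _ (le_max_right _ _))
  rw [prec_iff]
  rintro (h | ⟨h1, h2, i, h3⟩)
  · exact hj h
  · obtain ⟨t, ⟨i, hi⟩ | ⟨hlen, hd⟩⟩ := hd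
    · exact h1 ⟨i, cost_lt_of_low hi⟩
    · have ht := length_summary.1 hlen
      simp only [high_iff hN ht] at hd
      rcases hd with hd | hd
      · exact h2 hd
      · exact hd i h3

end Summary

/-! ### Punishing a deviating player with finite memory -/

/-- After the history `h`, the players other than `j` prevent, by following `σ`,
player `j` from obtaining costs which he prefers to `x`. -/
def Punishes (G : QRGame ι V) (v₀ : V) (σ : ι → List V → V) (x : ι → ℕ∞) (j : ι)
    (h : List V) : Prop :=
  G.IsHist v₀ h ∧ ∀ ρ, G.IsPlay v₀ ρ → initHist ρ h.length = h →
    (∀ t, h.length ≤ t + 1 → G.ConsistentAt σ j ρ t) → ¬ Prec j x (fun i => G.cost i ρ)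

section Punish

variable {G : QRGame ι V} {v₀ : V} {σ : ι → List V → V} {x : ι → ℕ∞} {j : ι}

lemma Punishes.cons {h : List V} {v : V} (hp : G.Punishes v₀ σ x j h)
    (hE : G.E (cur v₀ h) v)
    (hv : G.owner (cur v₀ h) ≠ j → v = σ (G.owner (cur v₀ h)) h) :
    G.Punishes v₀ σ x j (v :: h) := by
  refine ⟨hp.1.cons hE, fun ρ hρ hh hc => ?_⟩
  simp only [List.length_cons, initHist, List.cons.injEq] at hh
  refine hp.2 ρ hρ hh.2 fun t ht => ?_
  rcases ht.eq_or_lt with ht | ht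
  · intro ho
    have hh' := hh.2
    rw [ht] at hh'
    rw [← hh', cur_initHist_succ] at hv
    rw [← hv ho, ← ht, hh.1]
  · exact hc t ht

lemma exists_extension_of_isHist {P : List V → Prop}
    (hstep : ∀ h, G.IsHist v₀ h → P h → ∃ v, G.E (cur v₀ h) v ∧
      (G.owner (cur v₀ h) ≠ j → v = σ (G.owner (cur v₀ h)) h) ∧ P (v :: h))
    {h₀ : List V} (hh₀ : G.IsHist v₀ h₀) (hP : P h₀) :
    ∃ ρ, G.IsPlay v₀ ρ ∧ initHist ρ h₀.length = h₀ ∧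
      (∀ t, h₀.length ≤ t + 1 → G.ConsistentAt σ j ρ t) ∧
      ∀ t, h₀.length ≤ t → P (initHist ρ t) := by
  obtain ⟨ρ, h1, h2⟩ := exists_extension (P := fun h => G.IsHist v₀ h ∧ P h)
    (R := fun h v => G.E (cur v₀ h) v ∧
      (G.owner (cur v₀ h) ≠ j → v = σ (G.owner (cur v₀ h)) h))
    (fun h hh => by
      obtain ⟨v, hE, hv, hPv⟩ := hstep h hh.1 hh.2
      exact ⟨v, ⟨hE, hv⟩, hh.1.cons hE, hPv⟩) ⟨hh₀, hP⟩
  obtain ⟨n, hn⟩ := Nat.exists_eq_succ_of_ne_zero (mt List.length_eq_zero_iff.1 hh₀.ne_nil)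
  rw [hn] at h2
  refine ⟨ρ, isPlay_of_isHist (n := n) ?_ (fun t ht => ?_), h1, fun t ht => ?_,
    fun t ht => (h2 t (hn ▸ ht)).1.2⟩
  · rw [← Nat.succ_eq_add_one, ← hn, h1]
    exact hh₀
  · exact (h2 (t + 1) (Nat.succ_le_succ ht)).2.1
  · exact (h2 (t + 1) (hn ▸ ht)).2.2

variable (G v₀ σ x j)

/-- The summaries of the histories after which `σ` punishes player `j`. -/
def PunishSummary (N : ℕ) (s : Summary ι V) : Prop :=
  ∃ h, G.Punishes v₀ σ x j h ∧ G.summary v₀ N h = s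

/-- The summaries from which the players other than `j` can force `Summary.Done` in `n` steps,
while only visiting summaries satisfying `PunishSummary`. -/
def Attractor (N : ℕ) : ℕ → Summary ι V → Prop
  | 0, s => G.PunishSummary v₀ σ x j N s ∧ s.Done G N x j
  | n + 1, s => Attractor N n s ∨ G.PunishSummary v₀ σ x j N s ∧
      (G.owner s.1 = j → ∀ v, G.E s.1 v → Attractor N n (s.step G N v)) ∧
      (G.owner s.1 ≠ j → ∃ v, G.E s.1 v ∧ Attractor N n (s.step G N v))

variable {G v₀ σ x j} {N : ℕ}

lemma Attractor.mono {s : Summary ι V} {m n : ℕ} (hmn : m ≤ n)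
    (h : G.Attractor v₀ σ x j N m s) : G.Attractor v₀ σ x j N n s := by
  induction hmn with
  | refl => exact h
  | step _ ih => exact Or.inl ih

lemma Attractor.punishSummary {s : Summary ι V} {n : ℕ}
    (h : G.Attractor v₀ σ x j N n s) : G.PunishSummary v₀ σ x j N s := by
  induction n with
  | zero => exact h.1
  | succ n ih =>
    rcases h with h | h
    · exact ih h
    · exact h.1

lemma PunishSummary.step_of_owner {s : Summary ι V} (hs : G.PunishSummary v₀ σ x j N s)
    (ho : G.owner s.1 = j) {v : V} (hE : G.E s.1 v) :
    G.PunishSummary v₀ σ x j N (s.step G N v) := by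
  obtain ⟨h, hp, rfl⟩ := hs
  rw [summary_fst] at ho hE
  exact ⟨v :: h, hp.cons hE fun hne => (hne ho).elim, rfl⟩

lemma PunishSummary.exists_step (hσ : G.IsProfile v₀ σ) {s : Summary ι V}
    (hs : G.PunishSummary v₀ σ x j N s) :
    ∃ v, G.E s.1 v ∧ G.PunishSummary v₀ σ x j N (s.step G N v) := by
  obtain ⟨h, hp, rfl⟩ := hs
  have hE := hσ (G.owner (cur v₀ h)) h hp.1 rfl
  refine ⟨_, ?_, _ :: h, hp.cons hE fun _ => rfl, rfl⟩
  rwa [summary_fst]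

lemma PunishSummary.not_low (hσ : G.IsProfile v₀ σ) {s : Summary ι V}
    (hs : G.PunishSummary v₀ σ x j N s) : ¬ s.Low G x j := by
  obtain ⟨h, hp, rfl⟩ := hs
  obtain ⟨ρ, h1, h2, h3, -⟩ := exists_extension_of_isHist (σ := σ) (j := j)
    (P := fun _ => True) (fun h hh _ => ⟨σ (G.owner (cur v₀ h)) h, hσ _ h hh rfl,
      fun _ => rfl, trivial⟩) hp.1 trivial
  intro hl
  rw [← h2] at hl
  exact hp.2 ρ h1 h2 h3 (Or.inl (cost_lt_of_low hl))

lemma PunishSummary.exists_attractor [Finite V] (hσ : G.IsProfile v₀ σ)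
    (hN : ∀ i, x i = ⊤ ∨ x i ≤ N) {s : Summary ι V} (hs : G.PunishSummary v₀ σ x j N s) :
    ∃ n, G.Attractor v₀ σ x j N n s := by
  obtain ⟨h, hp, rfl⟩ := hs
  by_contra hA
  have hstep : ∀ h, G.IsHist v₀ h → (G.Punishes v₀ σ x j h ∧
      ¬ ∃ n, G.Attractor v₀ σ x j N n (G.summary v₀ N h)) → ∃ v, G.E (cur v₀ h) v ∧
      (G.owner (cur v₀ h) ≠ j → v = σ (G.owner (cur v₀ h)) h) ∧
      (G.Punishes v₀ σ x j (v :: h) ∧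
        ¬ ∃ n, G.Attractor v₀ σ x j N n (G.summary v₀ N (v :: h))) := by
    rintro h hh ⟨hP, hA⟩
    by_cases ho : G.owner (cur v₀ h) = j
    · by_contra! hc
      have hall : ∀ v, ∃ n, G.E (cur v₀ h) v →
          G.Attractor v₀ σ x j N n ((G.summary v₀ N h).step G N v) := by
        intro v
        by_cases hE : G.E (cur v₀ h) v
        · obtain ⟨n, hn⟩ := hc v hE (fun hne => (hne ho).elim)
            (hP.cons hE fun hne => (hne ho).elim)
          exact ⟨n, fun _ => hn⟩
        · exact ⟨0, fun h => (hE h).elim⟩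
      choose n hn using hall
      obtain ⟨b, hb⟩ := (Set.finite_range n).bddAbove
      refine hA ⟨b + 1, Or.inr ⟨⟨h, hP, rfl⟩, fun _ v hE => ?_, fun hne => ?_⟩⟩
      · rw [summary_fst] at hE
        exact (hn v hE).mono (hb ⟨v, rfl⟩)
      · rw [summary_fst] at hne
        exact (hne ho).elim
    · have hE := hσ (G.owner (cur v₀ h)) h hP.1 rfl
      refine ⟨_, hE, fun _ => rfl, hP.cons hE fun _ => rfl, ?_⟩
      rintro ⟨n, hn⟩
      refine hA ⟨n + 1, Or.inr ⟨⟨h, hP, rfl⟩, fun h' => ?_, fun _ => ⟨_, ?_, hn⟩⟩⟩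
      · rw [summary_fst] at h'
        exact (ho h').elim
      · rwa [summary_fst]
  obtain ⟨ρ, h1, h2, h3, h4⟩ := exists_extension_of_isHist hstep hp.1 ⟨hp, hA⟩
  obtain ⟨T, hT⟩ := exists_forall_done (v₀ := v₀) hN (hp.2 ρ h1 h2 h3)
  obtain ⟨hq, hn⟩ := h4 (max T h.length) (le_max_right _ _)
  exact hn ⟨0, ⟨_, hq, rfl⟩, hT _ (le_max_left _ _)⟩

/-- A memoryless punishment on summaries: it stays in `PunishSummary` and decreases the
distance to `Summary.Done`. -/
lemma exists_punishment (hσ : G.IsProfile v₀ σ) (j : ι) (s : Summary ι V) :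
    ∃ v, G.PunishSummary v₀ σ x j N s → G.owner s.1 ≠ j →
      G.E s.1 v ∧ G.PunishSummary v₀ σ x j N (s.step G N v) ∧
      ∀ n, G.Attractor v₀ σ x j N n s →
        s.Done G N x j ∨ ∃ k < n, G.Attractor v₀ σ x j N k (s.step G N v) := by
  by_cases hs : G.PunishSummary v₀ σ x j N s ∧ G.owner s.1 ≠ j
  swap
  · exact ⟨s.1, fun h1 h2 => (hs ⟨h1, h2⟩).elim⟩
  by_cases hA : (∃ n, G.Attractor v₀ σ x j N n s) ∧ ¬ s.Done G N x j
  · obtain ⟨hA, hd⟩ := hA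
    have hmin := Nat.find_spec hA
    have hlt := fun k => Nat.find_min hA (m := k)
    have hle := fun k (hk : G.Attractor v₀ σ x j N k s) => Nat.find_min' hA hk
    generalize Nat.find hA = n at hmin hlt hle
    cases n with
    | zero => exact (hd hmin.2).elim
    | succ n =>
      rcases hmin with h | ⟨-, -, h⟩
      · exact (hlt n (Nat.lt_succ_self n) h).elim
      · obtain ⟨v, hE, hv⟩ := h hs.2
        exact ⟨v, fun _ _ => ⟨hE, hv.punishSummary, fun m hm => Or.inr ⟨n, hle m hm, hv⟩⟩⟩
  · obtain ⟨v, hE, hv⟩ := hs.1.exists_step hσ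
    refine ⟨v, fun _ _ => ⟨hE, hv, fun n hn => Or.inl ?_⟩⟩
    by_contra hd
    exact hA ⟨⟨n, hn⟩, hd⟩

/-- A play following a punishment from some point on is not profitable for player `j`. -/
lemma not_prec_of_punishment [Finite V] (hσ : G.IsProfile v₀ σ)
    (hN : ∀ i, x i = ⊤ ∨ x i ≤ N) {pun : Summary ι V → V}
    (hpun : ∀ s, G.PunishSummary v₀ σ x j N s → G.owner s.1 ≠ j →
      G.E s.1 (pun s) ∧ G.PunishSummary v₀ σ x j N (s.step G N (pun s)) ∧
      ∀ n, G.Attractor v₀ σ x j N n s →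
        s.Done G N x j ∨ ∃ k < n, G.Attractor v₀ σ x j N k (s.step G N (pun s)))
    {ρ : ℕ → V} (hρ : G.IsPlay v₀ ρ) {T : ℕ}
    (hT : G.PunishSummary v₀ σ x j N (G.summary v₀ N (initHist ρ (T + 1))))
    (hc : ∀ t, T ≤ t → G.PunishSummary v₀ σ x j N (G.summary v₀ N (initHist ρ (t + 1))) →
      G.owner (ρ t) ≠ j → ρ (t + 1) = pun (G.summary v₀ N (initHist ρ (t + 1)))) :
    ¬ Prec j x (fun i => G.cost i ρ) := by
  have hfst : ∀ t, (G.summary v₀ N (initHist ρ (t + 1))).1 = ρ t := fun t => rfl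
  have hstay : ∀ t, T ≤ t →
      G.PunishSummary v₀ σ x j N (G.summary v₀ N (initHist ρ (t + 1))) := by
    intro t ht
    induction t, ht using Nat.le_induction with
    | base => exact hT
    | succ t ht ih =>
      rw [initHist, summary_cons]
      by_cases ho : G.owner (ρ t) = j
      · exact ih.step_of_owner (by rwa [hfst]) (by rw [hfst]; exact hρ.2 t)
      · rw [hc t ht ih ho]
        exact (hpun _ ih (by rwa [hfst])).2.1
  refine not_prec_of_done (v₀ := v₀) hN ?_ ⟨T + 1, fun t ht => ?_⟩
  · have key : ∀ n t, T ≤ t → G.Attractor v₀ σ x j N n (G.summary v₀ N (initHist ρ (t + 1))) →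
        ∃ t, (G.summary v₀ N (initHist ρ t)).Done G N x j := by
      intro n
      induction n using Nat.strong_induction_on with
      | _ n ih =>
        intro t ht hA
        by_cases ho : G.owner (ρ t) = j
        · cases n with
          | zero => exact ⟨_, hA.2⟩
          | succ n =>
            rcases hA with hA | ⟨-, hA, -⟩
            · exact ih n (Nat.lt_succ_self n) t ht hA
            · refine ih n (Nat.lt_succ_self n) (t + 1) (by omega) ?_
              exact hA ho _ (hρ.2 t)
        · rcases (hpun _ (hstay t ht) (by rwa [hfst])).2.2 n hA with hd | ⟨k, hk, hA'⟩
          · exact ⟨_, hd⟩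
          · refine ih k hk (t + 1) (by omega) ?_
            rwa [← hc t ht (hstay t ht) ho] at hA'
    obtain ⟨n, hn⟩ := (hstay T le_rfl).exists_attractor hσ hN
    exact key n T le_rfl hn
  · obtain ⟨t, rfl⟩ := Nat.exists_eq_add_of_le' (Nat.one_le_of_lt ht)
    exact (hstay t (by omega)).not_low hσ

lemma punishes_initHist [DecidableEq ι] (hσ : G.IsProfile v₀ σ) (hsec : G.IsSecure v₀ σ)
    {ρ : ℕ → V} (h0 : ρ 0 = v₀)
    (hs : ∀ t, ρ (t + 1) = σ (G.owner (ρ t)) (initHist ρ (t + 1))) (j : ι) (n : ℕ) :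
    G.Punishes v₀ σ (fun i => G.cost i ρ) j (initHist ρ (n + 1)) := by
  induction n with
  | zero =>
    refine ⟨h0, fun ρ' hρ' _ hc => ?_⟩
    have := hsec.not_prec hσ hρ' fun t => hc t (by simp)
    rwa [fullPlay_eq h0 hs] at this
  | succ n ih =>
    exact ih.cons ((isPlay_of_isProfile hσ h0 hs).2 n) fun _ => hs n

end Punish

/-! ### Lassos -/

/-- The index in a sequence of the `t`-th vertex of the lasso which, instead of visiting
index `b`, returns to index `a`. -/
def lassoIdx (a b : ℕ) : ℕ → ℕ
  | 0 => 0
  | t + 1 => if lassoIdx a b t + 1 = b then a else lassoIdx a b t + 1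

lemma lassoIdx_lt {a b : ℕ} (hab : a < b) (t : ℕ) : lassoIdx a b t < b := by
  induction t with
  | zero => exact Nat.zero_lt_of_lt hab
  | succ t ih =>
    rw [lassoIdx]
    split_ifs <;> omega

lemma lassoIdx_of_lt {a b t : ℕ} (ht : t < b) : lassoIdx a b t = t := by
  induction t with
  | zero => rfl
  | succ t ih =>
    rw [lassoIdx, ih (by omega), if_neg (by omega)]

lemma lassoIdx_pos {a b t : ℕ} (ha : 0 < a) (ht : 0 < t) : 0 < lassoIdx a b t := by
  obtain ⟨t, rfl⟩ := Nat.exists_eq_add_of_le' ht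
  rw [lassoIdx]
  split_ifs <;> omega

section Lasso

variable {G : QRGame ι V} {v₀ : V} {N a b : ℕ} {ρ : ℕ → V}

lemma summary_lasso
    (hs : G.summary v₀ N (initHist ρ a) = G.summary v₀ N (initHist ρ b)) (t : ℕ) :
    G.summary v₀ N (initHist (fun t => ρ (lassoIdx a b t)) t) =
      G.summary v₀ N (initHist ρ (lassoIdx a b t)) := by
  induction t with
  | zero => rfl
  | succ t ih =>
    have : G.summary v₀ N (initHist (fun t => ρ (lassoIdx a b t)) (t + 1)) =
        G.summary v₀ N (initHist ρ (lassoIdx a b t + 1)) := by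
      rw [initHist, summary_cons, ih]
      rfl
    rw [this, lassoIdx]
    split_ifs with h
    · rw [h, hs]
    · rfl

lemma isPlay_lasso (ha : 0 < a) (hρ : G.IsPlay v₀ ρ)
    (hs : G.summary v₀ N (initHist ρ a) = G.summary v₀ N (initHist ρ b)) :
    G.IsPlay v₀ (fun t => ρ (lassoIdx a b t)) := by
  refine ⟨hρ.1, fun t => ?_⟩
  have h := congrArg Prod.fst (summary_lasso hs (t + 1))
  obtain ⟨n, hn⟩ := Nat.exists_eq_add_of_le' (lassoIdx_pos (b := b) ha (Nat.succ_pos t))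
  rw [hn] at h
  simp only [summary_fst, cur_initHist_succ] at h
  beta_reduce
  rw [hn, h]
  exact hρ.2 n

lemma cost_lasso (hab : a < b) (hN : ∀ i, G.cost i ρ = ⊤ ∨ G.cost i ρ ≤ N) (ha : N < a)
    (i : ι) : G.cost i (fun t => ρ (lassoIdx a b t)) = G.cost i ρ := by
  refine le_antisymm (not_lt.1 fun h => ?_) (not_lt.1 fun h => ?_)
  · obtain ⟨c, hc, hF⟩ := lt_cost_iff.1 h
    have hcN : c ≤ N := by
      rcases hN i with hi | hi
      · simp [hi] at hc
      · exact Nat.cast_le.1 (hc ▸ hi)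
    have : G.cost i ρ < ((c + 1 : ℕ) : ℕ∞) := by
      rw [hc]
      exact Nat.cast_lt.2 (Nat.lt_succ_self c)
    obtain ⟨l, hl, hlF⟩ := cost_lt_iff.1 this
    have hlc : l ≤ c := Nat.lt_succ_iff.1 (Nat.cast_lt.1 hl)
    apply hF l hlc
    rwa [lassoIdx_of_lt (by omega)]
  · obtain ⟨l, hl, hlF⟩ := cost_lt_iff.1 h
    have hle : G.cost i ρ ≤ (lassoIdx a b l : ℕ∞) :=
      iInf₂_le (f := fun (l : ℕ) (_ : l ∈ {l : ℕ | ρ l ∈ G.F i}) => (l : ℕ∞)) _ hlF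
    rcases hN i with hi | hi
    · rw [hi] at hle
      exact ENat.natCast_ne_top _ (top_le_iff.1 hle)
    · have hlN : l < N := Nat.cast_lt.1 (hl.trans_le hi)
      rw [lassoIdx_of_lt (by omega)] at hle
      exact absurd hl (not_lt.2 hle)

end Lasso

/-! ### Finite-memory strategies -/

lemma finMem_of_congr {S : Type*} (f : List V → S) (hf : (Set.range f).Finite)
    (hcons : ∀ v h h', f h = f h' → f (v :: h) = f (v :: h')) {σ : List V → V}
    (hσ : ∀ h h', f h = f h' → σ h = σ h') : FinMem σ := by
  have happ : ∀ δ h h', f h = f h' → f (δ ++ h) = f (δ ++ h') := by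
    intro δ h h' he
    induction δ with
    | nil => exact he
    | cons v δ ih => exact hcons v _ _ ih
  have hfac : Function.FactorsThrough (fun h δ : List V => σ (δ ++ h)) f := by
    intro h h' he
    funext δ
    exact hσ _ _ (happ δ h h' he)
  refine (hf.image (Function.extend f (fun h δ : List V => σ (δ ++ h)) fun _ _ => σ [])).subset ?_
  rintro _ ⟨h, rfl⟩
  exact ⟨f h, ⟨h, rfl⟩, hfac.extend_apply _ h⟩

/-- The player who first left the play `π`, if any. -/
noncomputable def deviator (G : QRGame ι V) (v₀ : V) (π : ℕ → V) : List V → Option ι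
  | [] => none
  | v :: h => (deviator G v₀ π h).elim
      (if v = π h.length then none else some (G.owner (cur v₀ h))) some

lemma deviator_initHist (G : QRGame ι V) (v₀ : V) (π : ℕ → V) (n : ℕ) :
    G.deviator v₀ π (initHist π n) = none := by
  induction n with
  | zero => rfl
  | succ n ih => simp [initHist, deviator, ih]

lemma deviator_eq_some {G : QRGame ι V} {v₀ : V} {π ρ : ℕ → V} {k : ℕ}
    (heq : ∀ t ≤ k, ρ t = π t) (hne : ρ (k + 1) ≠ π (k + 1)) {n : ℕ} (hn : k + 1 ≤ n) :
    G.deviator v₀ π (initHist ρ (n + 1)) = some (G.owner (ρ k)) := by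
  induction n, hn using Nat.le_induction with
  | base =>
    have h : initHist ρ (k + 1) = initHist π (k + 1) :=
      initHist_congr fun t ht => heq t (Nat.lt_succ_iff.1 ht)
    rw [initHist, deviator, h, deviator_initHist]
    simp [hne, heq k le_rfl]
  | succ n hn ih =>
    rw [initHist, deviator, ih]
    rfl

/-- Follow `π` until some player `j` leaves it, then answer according to `pun j`;
illegal moves are replaced by legal ones. -/
noncomputable def punishStrategy (G : QRGame ι V) (v₀ : V) (N : ℕ) (π : ℕ → V)
    (pun : ι → Summary ι V → V) (h : List V) : V :=
  let w := (G.deviator v₀ π h).elim (π h.length) fun j => pun j (G.summary v₀ N h)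
  if G.E (cur v₀ h) w then w else (G.total (cur v₀ h)).choose

section PunishStrategy

variable {G : QRGame ι V} {v₀ : V} {N : ℕ} {π : ℕ → V} {pun : ι → Summary ι V → V}

lemma edge_punishStrategy (h : List V) : G.E (cur v₀ h) (G.punishStrategy v₀ N π pun h) := by
  unfold punishStrategy
  dsimp only
  split_ifs with hE
  · exact hE
  · exact (G.total (cur v₀ h)).choose_spec

lemma punishStrategy_initHist (hπ : G.IsPlay v₀ π) (n : ℕ) :
    G.punishStrategy v₀ N π pun (initHist π (n + 1)) = π (n + 1) := by
  unfold punishStrategy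
  dsimp only
  rw [deviator_initHist, Option.elim_none, length_initHist]
  exact if_pos (hπ.2 n)

lemma punishStrategy_of_deviator {h : List V} {j : ι} (hd : G.deviator v₀ π h = some j)
    (hE : G.E (cur v₀ h) (pun j (G.summary v₀ N h))) :
    G.punishStrategy v₀ N π pun h = pun j (G.summary v₀ N h) := by
  unfold punishStrategy
  dsimp only
  rw [hd, Option.elim_some, if_pos hE]

lemma finMem_punishStrategy [Finite ι] [Finite V] {a b : ℕ} (hab : a < b) (ρ : ℕ → V) :
    FinMem (G.punishStrategy v₀ N (fun t => ρ (lassoIdx a b t)) pun) := by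
  refine finMem_of_congr (fun h => (G.summary v₀ N h, lassoIdx a b h.length,
    G.deviator v₀ (fun t => ρ (lassoIdx a b t)) h)) ?_ ?_ ?_
  · refine ((finite_range_summary (G := G) (v₀ := v₀) (N := N)).prod
      ((Set.finite_Iio b).prod (Set.finite_univ (α := Option ι)))).subset ?_
    rintro _ ⟨h, rfl⟩
    exact ⟨⟨h, rfl⟩, lassoIdx_lt hab _, trivial⟩
  · intro v h h' he
    simp only [Prod.mk.injEq] at he ⊢
    obtain ⟨h1, h2, h3⟩ := he
    have hcur : cur v₀ h = cur v₀ h' := by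
      rw [← summary_fst (G := G) (N := N), h1, summary_fst]
    refine ⟨by rw [summary_cons, summary_cons, h1], ?_, ?_⟩
    · simp only [List.length_cons, lassoIdx, h2]
    · simp only [deviator, h2, h3, hcur]
  · intro h h' he
    simp only [Prod.mk.injEq] at he
    obtain ⟨h1, h2, h3⟩ := he
    have hcur : cur v₀ h = cur v₀ h' := by
      rw [← summary_fst (G := G) (N := N), h1, summary_fst]
    simp only [punishStrategy, h1, h2, h3, hcur]

end PunishStrategy

lemma exists_bound_of_ne_top [Finite ι] (x : ι → ℕ∞) : ∃ N : ℕ, ∀ i, x i = ⊤ ∨ x i ≤ N := by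
  obtain ⟨N, hN⟩ := (Set.finite_range fun i => (x i).toNat).bddAbove
  refine ⟨N, fun i => or_iff_not_imp_left.2 fun hi => ?_⟩
  rw [← ENat.natCast_toNat hi]
  exact Nat.cast_le.2 (hN ⟨i, rfl⟩)

lemma exists_summary_repeat [Finite ι] [Finite V] (G : QRGame ι V) (v₀ : V) (N : ℕ)
    (ρ : ℕ → V) : ∃ a b, N < a ∧ a < b ∧
      G.summary v₀ N (initHist ρ a) = G.summary v₀ N (initHist ρ b) := by
  obtain ⟨a, ha, b, hb, hab, he⟩ := (Set.Ioi_infinite N).exists_lt_map_eq_of_mapsTo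
    (f := fun n => G.summary v₀ N (initHist ρ n)) (t := Set.range (G.summary v₀ N))
    (fun n _ => ⟨_, rfl⟩) finite_range_summary
  exact ⟨a, b, ha, hab, he⟩

end QRGame

open QRGame

/-- If there exists a secure equilibrium in a multiplayer quantitative
reachability game `(G, v₀)`, then there exists a secure equilibrium in
`(G, v₀)` that is finite-memory. -/
theorem exists_finite_memory_secure_equilibrium
    {ι V : Type} [Fintype ι] [Fintype V] [DecidableEq ι]
    (G : QRGame ι V) (v₀ : V)
    (hex : ∃ σ : ι → List V → V, G.IsProfile v₀ σ ∧ G.IsSecure v₀ σ) :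
    ∃ τ : ι → List V → V, G.IsProfile v₀ τ ∧ G.IsSecure v₀ τ ∧
      ∀ i, QRGame.FinMem (τ i) := by
  obtain ⟨σ, hσ, hsec⟩ := hex
  obtain ⟨ρ, h0, hs⟩ := exists_outcome G v₀ σ
  have hρ := isPlay_of_isProfile hσ h0 hs
  obtain ⟨N, hN⟩ := exists_bound_of_ne_top fun i => G.cost i ρ
  obtain ⟨a, b, hNa, hab, hrep⟩ := exists_summary_repeat G v₀ N ρ
  choose pun hpun using exists_punishment (G := G) (x := fun i => G.cost i ρ) (N := N) hσ
  have hπ := isPlay_lasso (Nat.zero_lt_of_lt hNa) hρ hrep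
  have hcost : ∀ i, G.cost i (fun t => ρ (lassoIdx a b t)) = G.cost i ρ :=
    cost_lasso hab hN hNa
  have hfm := finMem_punishStrategy (G := G) (v₀ := v₀) (N := N) (pun := pun) hab ρ
  have hsum := summary_lasso hrep
  generalize (fun t => ρ (lassoIdx a b t)) = π at hπ hcost hfm hsum
  have hτ : G.IsProfile v₀ fun _ => G.punishStrategy v₀ N π pun :=
    fun _ h _ _ => edge_punishStrategy h
  refine ⟨fun _ => G.punishStrategy v₀ N π pun, hτ, ?_, fun _ => hfm⟩
  refine isSecure_of_not_prec hτ fun j ρ' hρ' hc => ?_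
  have hplay : G.fullPlay v₀ (fun _ => G.punishStrategy v₀ N π pun) [v₀] = π :=
    fullPlay_eq hπ.1 fun t => (punishStrategy_initHist hπ t).symm
  rw [hplay]
  simp only [hcost]
  by_cases heq : ρ' = π
  · subst heq
    simp [hcost, Prec]
  have hex : ∃ t, ρ' t ≠ π t := by
    by_contra! h
    exact heq (funext h)
  obtain ⟨k, hk⟩ : ∃ k, Nat.find hex = k + 1 := by
    refine Nat.exists_eq_succ_of_ne_zero fun h => Nat.find_spec hex ?_
    rw [h, hρ'.1, hπ.1]
  have hne : ρ' (k + 1) ≠ π (k + 1) := hk ▸ Nat.find_spec hex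
  have hagree : ∀ t ≤ k, ρ' t = π t := fun t ht =>
    not_not.1 (Nat.find_min hex (hk ▸ Nat.lt_succ_of_le ht))
  have hhist : initHist ρ' (k + 1) = initHist π (k + 1) :=
    initHist_congr fun t ht => hagree t (Nat.lt_succ_iff.1 ht)
  have hj : G.owner (ρ' k) = j := by
    by_contra ho
    apply hne
    rw [hc k ho, hhist]
    exact punishStrategy_initHist hπ k
  have hQ : G.PunishSummary v₀ σ (fun i => G.cost i ρ) j N
      (G.summary v₀ N (initHist ρ' (k + 1))) := by
    obtain ⟨n, hn⟩ := Nat.exists_eq_add_of_le'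
      (lassoIdx_pos (b := b) (Nat.zero_lt_of_lt hNa) (Nat.succ_pos k))
    rw [hhist, hsum, hn]
    exact ⟨_, punishes_initHist hσ hsec h0 hs j n, rfl⟩
  refine not_prec_of_punishment hσ hN (hpun j) hρ' (T := k + 1)
    (hQ.step_of_owner hj (hρ'.2 k)) fun t ht hQt ho => ?_
  rw [hc t ho]
  refine punishStrategy_of_deviator (hj ▸ deviator_eq_some hagree hne ht) ?_
  exact (hpun j _ hQt ho).1
end
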